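/- arXiv:1808.05501 — 4 statements merged into one kernel-verified Lean document; each statement's English description precedes it below -/
import Mathlib

section
/- For every positive integer x, there exists a finite set A of integers with A ⊆ {0,1,…,12+4x} such that |A+A| − |A−A| = x. -/
open Pointwise

/-- Membership predicate of the basic set inside `[0, 8k+1]`. -/
def MP (k a : ℤ) : Prop :=
  0 ≤ a ∧ a ≤ 8 * k + 1 ∧
    (a % 8 = 0 ∨ a % 8 = 4 ∨ a % 8 = 5 ∨ a = 1 ∨ a = 3 ∨ a = 8 * k - 1 ∨ a = 8 * k + 1)

lemma MP_sum (k s : ℤ) (hk : 2 ≤ k) (h2 : 2 ≤ s) (hs : s ≤ 16 * k + 2) (h3 : s ≠ 3) :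
    ∃ a b, (MP k a ∧ a ≠ 0) ∧ (MP k b ∧ b ≠ 0) ∧ a + b = s := by
  have key : ∀ a : ℤ, (MP k a ∧ a ≠ 0) → (MP k (s - a) ∧ s - a ≠ 0) →
      ∃ a b, (MP k a ∧ a ≠ 0) ∧ (MP k b ∧ b ≠ 0) ∧ a + b = s :=
    fun a ha hb => ⟨a, s - a, ha, hb, by ring⟩
  unfold MP at key
  unfold MP
  obtain ⟨q, r, hr0, hr8, rfl⟩ : ∃ q r : ℤ, 0 ≤ r ∧ r < 8 ∧ s = 8 * q + r :=
    ⟨s / 8, s % 8, by omega, by omega, by omega⟩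
  obtain h | h | h | h | h | h | h | h : r = 0 ∨ r = 1 ∨ r = 2 ∨ r = 3 ∨ r = 4 ∨ r = 5 ∨
    r = 6 ∨ r = 7 := by omega
  all_goals subst h
  · by_cases h1 : q = 1
    · exact key 3 (by omega) (by omega)
    by_cases h4 : q ≤ k
    · exact key 8 (by omega) (by omega)
    · exact key (8 * k) (by omega) (by omega)
  · by_cases h1 : q = 2 * k
    · exact key (8 * k) (by omega) (by omega)
    by_cases h4 : q ≤ k
    · exact key 4 (by omega) (by omega)
    · exact key (8 * k - 4) (by omega) (by omega)
  · by_cases h0 : q = 0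
    · exact key 1 (by omega) (by omega)
    by_cases h1 : q = 2 * k
    · exact key (8 * k + 1) (by omega) (by omega)
    by_cases h4 : q ≤ k
    · exact key 5 (by omega) (by omega)
    · exact key (8 * k - 3) (by omega) (by omega)
  · by_cases h4 : q ≤ k
    · exact key 3 (by omega) (by omega)
    · exact key (8 * k - 1) (by omega) (by omega)
  · by_cases h0 : q = 0
    · exact key 1 (by omega) (by omega)
    by_cases h4 : q ≤ k
    · exact key 8 (by omega) (by omega) 
    · exact key (8 * k) (by omega) (by omega)
  · by_cases h0 : q = 0
    · exact key 1 (by omega) (by omega)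
    by_cases h4 : q ≤ k
    · exact key 8 (by omega) (by omega) 
    · exact key (8 * k) (by omega) (by omega)
  · by_cases h4 : q < k
    · exact key 1 (by omega) (by omega)
    · exact key (8 * k + 1) (by omega) (by omega)
  · by_cases h4 : q < k
    · exact key 3 (by omega) (by omega)
    · exact key (8 * k - 1) (by omega) (by omega)

lemma MP_diff (k d : ℤ) (hk : 2 ≤ k) (h0 : 0 ≤ d) (hd : d ≤ 8 * k)
    (h6 : d % 8 ≠ 6 ∨ d = 8 * k - 2) :
    ∃ a b, (MP k a ∧ a ≠ 0) ∧ (MP k b ∧ b ≠ 0) ∧ a - b = d := by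
  have key : ∀ b : ℤ, (MP k b ∧ b ≠ 0) → (MP k (b + d) ∧ b + d ≠ 0) →
      ∃ a b, (MP k a ∧ a ≠ 0) ∧ (MP k b ∧ b ≠ 0) ∧ a - b = d :=
    fun b hb ha => ⟨b + d, b, ha, hb, by ring⟩
  unfold MP at key
  unfold MP
  obtain h | h | h | h | h | h | h | h : d % 8 = 0 ∨ d % 8 = 1 ∨ d % 8 = 2 ∨ d % 8 = 3 ∨
    d % 8 = 4 ∨ d % 8 = 5 ∨ d % 8 = 6 ∨ d % 8 = 7 := by omega
  · by_cases h1 : d = 8 * k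
    · exact key 1 (by omega) (by omega)
    · exact key 8 (by omega) (by omega)
  · exact key 4 (by omega) (by omega)
  · exact key 3 (by omega) (by omega)
  · exact key 5 (by omega) (by omega)
  · exact key 4 (by omega) (by omega)
  · exact key (8 * k + 1 - d) (by omega) (by omega)
  · exact key 1 (by omega) (by omega)
  · exact key 1 (by omega) (by omega)

lemma MP_no (k a b : ℤ) (ha : MP k a) (hb : MP k b) (h : 0 ≤ a - b) :
    (a - b) % 8 ≠ 6 ∨ a - b = 8 * k - 2 := by
  unfold MP at ha hb
  omega

/-- The missing differences. -/
noncomputable def MM (k : ℤ) : Finset ℤ :=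
  (Finset.Ico 0 (k - 1)).image (fun j => 8 * j + 6) ∪
    (Finset.Ico 0 (k - 1)).image (fun j => -(8 * j + 6))

lemma mem_MM (k d : ℤ) :
    d ∈ MM k ↔ (0 ≤ d ∧ d % 8 = 6 ∧ d < 8 * k - 2) ∨ (d ≤ 0 ∧ (-d) % 8 = 6 ∧ -d < 8 * k - 2) := by
  unfold MM
  simp only [Finset.mem_union, Finset.mem_image, Finset.mem_Ico]
  constructor
  · rintro (⟨j, hj, rfl⟩ | ⟨j, hj, rfl⟩) <;> omega
  · rintro (h | h)
    · exact Or.inl ⟨d / 8, by omega, by omega⟩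
    · exact Or.inr ⟨(-d) / 8, by omega, by omega⟩

lemma card_MM (k : ℤ) (hk : 2 ≤ k) : ((MM k).card : ℤ) = 2 * k - 2 := by
  unfold MM
  rw [Finset.card_union_of_disjoint, Finset.card_image_of_injective,
    Finset.card_image_of_injective, Int.card_Ico]
  · push_cast; omega
  · intro a b h; simp only at h; omega
  · intro a b h; simp only at h; omega
  · rw [Finset.disjoint_left]
    simp only [Finset.mem_image, Finset.mem_Ico]
    rintro x ⟨j, hj, rfl⟩ ⟨i, hi, h⟩
    omega

lemma card_D (k n : ℤ) (hk : 2 ≤ k) (hn : 8 * k ≤ n) :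
    (((Finset.Icc (-n) n) \ MM k).card : ℤ) = 2 * n + 1 - (2 * k - 2) := by
  rw [Finset.card_sdiff_of_subset, Nat.cast_sub, card_MM k hk, Int.card_Icc]
  · omega
  · apply Finset.card_le_card
    intro d hd; rw [mem_MM] at hd; rw [Finset.mem_Icc]; omega
  · intro d hd; rw [mem_MM] at hd; rw [Finset.mem_Icc]; omega

open Classical in
lemma even_case (k : ℤ) (hk : 2 ≤ k) :
    ∃ A : Finset ℤ, A ⊆ Finset.Icc 0 (8 * k + 1) ∧
      ((A + A).card : ℤ) - ((A - A).card : ℤ) = 2 * k - 2 := by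
  refine ⟨(Finset.Icc 0 (8 * k + 1)).filter (MP k), Finset.filter_subset _ _, ?_⟩
  set A := (Finset.Icc 0 (8 * k + 1)).filter (MP k) with hA
  have mA : ∀ a, a ∈ A ↔ MP k a := by
    intro a; simp only [hA, Finset.mem_filter, Finset.mem_Icc]; unfold MP; tauto
  have hS : A + A = Finset.Icc 0 (16 * k + 2) := by
    ext s
    simp only [Finset.mem_add, mA, Finset.mem_Icc]
    constructor
    · rintro ⟨a, ha, b, hb, rfl⟩
      unfold MP at ha hb; omega
    · rintro ⟨h0, h1⟩
      by_cases h : 2 ≤ s ∧ s ≠ 3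
      · obtain ⟨a, b, ha, hb, hab⟩ := MP_sum k s hk h.1 h1 h.2
        exact ⟨a, ha.1, b, hb.1, hab⟩
      · exact ⟨0, by unfold MP; omega, s, by unfold MP; omega, by ring⟩
  have pos : ∀ d, 0 ≤ d → d ≤ 8 * k + 1 → d ∉ MM k → ∃ a, MP k a ∧ ∃ b, MP k b ∧ a - b = d := by
    intro d h0 h1 h
    rw [mem_MM] at h
    by_cases h8 : d = 8 * k + 1
    · exact ⟨d, by unfold MP; omega, 0, by unfold MP; omega, by ring⟩
    · obtain ⟨a, b, ha, hb, hab⟩ := MP_diff k d hk h0 (by omega) (by omega)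
      exact ⟨a, ha.1, b, hb.1, hab⟩
  have hD : A - A = Finset.Icc (-(8 * k + 1)) (8 * k + 1) \ MM k := by
    ext d
    simp only [Finset.mem_sub, mA, Finset.mem_sdiff, Finset.mem_Icc]
    constructor
    · rintro ⟨a, ha, b, hb, rfl⟩
      have e1 := MP_no k a b ha hb
      have e2 := MP_no k b a hb ha
      rw [mem_MM]
      unfold MP at ha hb
      obtain ⟨ha1, ha2, -⟩ := ha
      obtain ⟨hb1, hb2, -⟩ := hb
      omega
    · rintro ⟨h0, h⟩
      by_cases hd : 0 ≤ d
      · exact pos d hd (by omega) h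
      · obtain ⟨a, ha, b, hb, hab⟩ := pos (-d) (by omega) (by omega)
          (by rw [mem_MM] at h ⊢; omega)
        exact ⟨b, hb, a, ha, by omega⟩
  rw [hS, hD, card_D k _ hk (by omega), Int.card_Icc]
  omega

open Classical in
lemma odd_case (k : ℤ) (hk : 2 ≤ k) :
    ∃ A : Finset ℤ, A ⊆ Finset.Icc 0 (8 * k) ∧
      ((A + A).card : ℤ) - ((A - A).card : ℤ) = 2 * k - 3 := by
  refine ⟨(Finset.Icc 0 (8 * k)).filter (fun a => MP k (a + 1)), Finset.filter_subset _ _, ?_⟩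
  set A := (Finset.Icc 0 (8 * k)).filter (fun a => MP k (a + 1)) with hA
  have mA : ∀ a, a ∈ A ↔ MP k (a + 1) ∧ a + 1 ≠ 0 := by
    intro a; simp only [hA, Finset.mem_filter, Finset.mem_Icc]; unfold MP; omega
  have hS : A + A = (Finset.Icc 0 (16 * k)).erase 1 := by
    ext s
    simp only [Finset.mem_add, mA, Finset.mem_Icc, Finset.mem_erase]
    constructor
    · rintro ⟨a, ha, b, hb, rfl⟩
      unfold MP at ha hb; omega
    · rintro ⟨h0, h1⟩
      obtain ⟨a, b, ha, hb, hab⟩ := MP_sum k (s + 2) hk (by omega) (by omega) (by omega)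
      exact ⟨a - 1, by simpa using ha, b - 1, by simpa using hb, by omega⟩
  have pos : ∀ d, 0 ≤ d → d ≤ 8 * k → d ∉ MM k →
      ∃ a, (MP k (a + 1) ∧ a + 1 ≠ 0) ∧ ∃ b, (MP k (b + 1) ∧ b + 1 ≠ 0) ∧ a - b = d := by
    intro d h0 h1 h
    rw [mem_MM] at h
    obtain ⟨a, b, ha, hb, hab⟩ := MP_diff k d hk h0 (by omega) (by omega)
    exact ⟨a - 1, by simpa using ha, b - 1, by simpa using hb, by omega⟩
  have hD : A - A = Finset.Icc (-(8 * k)) (8 * k) \ MM k := by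
    ext d
    simp only [Finset.mem_sub, mA, Finset.mem_sdiff, Finset.mem_Icc]
    constructor
    · rintro ⟨a, ⟨ha, ha0⟩, b, ⟨hb, hb0⟩, rfl⟩
      have e1 := MP_no k _ _ ha hb
      have e2 := MP_no k _ _ hb ha
      rw [mem_MM]
      unfold MP at ha hb
      obtain ⟨ha1, ha2, -⟩ := ha
      obtain ⟨hb1, hb2, -⟩ := hb
      rw [add_sub_add_right_eq_sub] at e1 e2
      omega
    · rintro ⟨h0, h⟩
      by_cases hd : 0 ≤ d
      · exact pos d hd (by omega) h
      · obtain ⟨a, ha, b, hb, hab⟩ := pos (-d) (by omega) (by omega)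
          (by rw [mem_MM] at h ⊢; omega)
        exact ⟨b, hb, a, ha, by omega⟩
  rw [hS, hD, card_D k _ hk (by omega), Finset.card_erase_of_mem, Int.card_Icc]
  · omega
  · rw [Finset.mem_Icc]; omega

theorem economical_mstd (x : ℤ) (hx : 1 ≤ x) :
    ∃ A : Finset ℤ, A ⊆ Finset.Icc 0 (12 + 4 * x) ∧
      ((A + A).card : ℤ) - ((A - A).card : ℤ) = x := by
  obtain ⟨k, h | h⟩ : ∃ k : ℤ, x = 2 * k - 2 ∨ x = 2 * k - 3 := ⟨(x + 3) / 2, by omega⟩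
  · obtain ⟨A, h1, h2⟩ := even_case k (by omega)
    exact ⟨A, h1.trans (Finset.Icc_subset_Icc le_rfl (by omega)), by rw [h2, h]⟩
  · obtain ⟨A, h1, h2⟩ := odd_case k (by omega)
    exact ⟨A, h1.trans (Finset.Icc_subset_Icc le_rfl (by omega)), by rw [h2, h]⟩
end

section
/- For every integer n ≥ 81, the number of RSD subsets of {0,1,…,n−1} is at least 4.135·10^(−25)·2^n; that is, the number of subsets A of {0,1,…,n−1} with |A+̂A| > |A−A| is at least (4135/10^28)·2^n. -/
open Pointwise

/-- The restricted sumset `A +̂ A = {a + b : a, b ∈ A, a ≠ b}`. -/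
def restSum (A : Finset ℤ) : Finset ℤ :=
  ((A ×ˢ A).filter (fun p => p.1 ≠ p.2)).image (fun p => p.1 + p.2)

lemma mem_restSum {A : Finset ℤ} {k x : ℤ} (hx : x ∈ A) (hy : k - x ∈ A) (h : 2 * x ≠ k) :
    k ∈ restSum A := by
  unfold restSum
  rw [Finset.mem_image]
  refine ⟨(x, k - x), ?_, by simp⟩
  simp only [Finset.mem_filter, Finset.mem_product]
  exact ⟨⟨hx, hy⟩, by omega⟩

/-- One pair `{x, y}`: at most three quarters of the patterns on it avoid containing both. -/
lemma one_pair (F S : Finset ℤ) (x y : ℤ) (hxy : x ≠ y) (hx : x ∈ S ∪ F) (hy : y ∈ S ∪ F) :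
    4 * ((S ∩ {x, y}).powerset.filter (fun C => ¬ (x ∈ F ∪ C ∧ y ∈ F ∪ C))).card
      ≤ 3 * 2 ^ (S ∩ {x, y}).card := by
  by_cases h1 : x ∈ F
  · by_cases h2 : y ∈ F
    · rw [Finset.filter_false_of_mem]
      · simp
      · intro C _
        simp [h1, h2]
    · have hyS : y ∈ S := by
        rcases Finset.mem_union.1 hy with h | h
        · exact h
        · exact absurd h h2
      have hsub : ((S ∩ {x, y}).powerset.filter (fun C => ¬ (x ∈ F ∪ C ∧ y ∈ F ∪ C)))
          ⊆ ((S ∩ {x, y}).erase y).powerset := by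
        intro C hC
        simp only [Finset.mem_filter, Finset.mem_powerset, Finset.mem_union] at hC ⊢
        intro z hz
        rw [Finset.mem_erase]
        refine ⟨?_, hC.1 hz⟩
        rintro rfl
        exact hC.2 ⟨Or.inl h1, Or.inr hz⟩
      have hm : y ∈ S ∩ {x, y} := by simp [hyS]
      have hc := Finset.card_le_card hsub
      rw [Finset.card_powerset] at hc
      have he := Finset.card_erase_add_one hm
      rw [← he, pow_succ]
      omega
  · have hxS : x ∈ S := by
      rcases Finset.mem_union.1 hx with h | h
      · exact h
      · exact absurd h h1
    by_cases h2 : y ∈ F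
    · have hsub : ((S ∩ {x, y}).powerset.filter (fun C => ¬ (x ∈ F ∪ C ∧ y ∈ F ∪ C)))
          ⊆ ((S ∩ {x, y}).erase x).powerset := by
        intro C hC
        simp only [Finset.mem_filter, Finset.mem_powerset, Finset.mem_union] at hC ⊢
        intro z hz
        rw [Finset.mem_erase]
        refine ⟨?_, hC.1 hz⟩
        rintro rfl
        exact hC.2 ⟨Or.inr hz, Or.inl h2⟩
      have hm : x ∈ S ∩ {x, y} := by simp [hxS]
      have hc := Finset.card_le_card hsub
      rw [Finset.card_powerset] at hc
      have he := Finset.card_erase_add_one hm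
      rw [← he, pow_succ]
      omega
    · have hyS : y ∈ S := by
        rcases Finset.mem_union.1 hy with h | h
        · exact h
        · exact absurd h h2
      have hS : S ∩ {x, y} = {x, y} := by
        apply Finset.inter_eq_right.2
        intro z hz
        simp only [Finset.mem_insert, Finset.mem_singleton] at hz
        rcases hz with rfl | rfl <;> assumption
      rw [hS, Finset.card_pair hxy]
      have hsub : (({x, y} : Finset ℤ).powerset.filter (fun C => ¬ (x ∈ F ∪ C ∧ y ∈ F ∪ C)))
          ⊆ ({x, y} : Finset ℤ).powerset.erase {x, y} := by
        intro C hC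
        simp only [Finset.mem_filter, Finset.mem_powerset] at hC
        rw [Finset.mem_erase, Finset.mem_powerset]
        refine ⟨?_, hC.1⟩
        rintro rfl
        apply hC.2
        simp
      have hc := Finset.card_le_card hsub
      rw [Finset.card_erase_of_mem (by simp), Finset.card_powerset, Finset.card_pair hxy] at hc
      omega

/-- Disjoint pairs `{x, k - x}`, `x ∈ P`. -/
lemma pair_count (F : Finset ℤ) (k : ℤ) (P : Finset ℤ) : ∀ S : Finset ℤ,
    (∀ x ∈ P, 2 * x < k ∧ x ∈ S ∪ F ∧ k - x ∈ S ∪ F) →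
    4 ^ P.card * (S.powerset.filter (fun B => ∀ x ∈ P, ¬ (x ∈ F ∪ B ∧ k - x ∈ F ∪ B))).card
      ≤ 3 ^ P.card * 2 ^ S.card := by
  induction P using Finset.induction_on with
  | empty => intro S _; simp
  | insert x P hxP ih =>
    intro S hS
    have hx := hS x (Finset.mem_insert_self _ _)
    have ih' := ih (S \ {x, k - x}) (by
      intro z hz
      have h := hS z (Finset.mem_insert_of_mem hz)
      have hzx : z ≠ x := by rintro rfl; exact hxP hz
      simp only [Finset.mem_union, Finset.mem_sdiff, Finset.mem_insert, Finset.mem_singleton] at h ⊢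
      refine ⟨h.1, ?_, ?_⟩
      · rcases h.2.1 with h' | h'
        · left; exact ⟨h', by omega⟩
        · right; exact h'
      · rcases h.2.2 with h' | h'
        · left; exact ⟨h', by omega⟩
        · right; exact h')
    have h1 := one_pair F S x (k - x) (by omega) hx.2.1 hx.2.2
    rw [Finset.card_insert_of_notMem hxP]
    have hcard : S.card = (S \ {x, k - x}).card + (S ∩ {x, k - x}).card :=
      (Finset.card_sdiff_add_card_inter _ _).symm
    have hinj : (S.powerset.filter
          (fun B => ∀ z ∈ insert x P, ¬ (z ∈ F ∪ B ∧ k - z ∈ F ∪ B))).card ≤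
        (((S \ {x, k - x}).powerset.filter
            (fun B => ∀ z ∈ P, ¬ (z ∈ F ∪ B ∧ k - z ∈ F ∪ B))) ×ˢ
          ((S ∩ {x, k - x}).powerset.filter
            (fun C => ¬ (x ∈ F ∪ C ∧ k - x ∈ F ∪ C)))).card := by
      apply Finset.card_le_card_of_injOn (fun B => (B \ {x, k - x}, B ∩ {x, k - x}))
      · intro B hB
        simp only [Finset.coe_filter, Finset.mem_powerset, Set.mem_ofPred_eq] at hB
        simp only [Finset.mem_coe, Finset.mem_product, Finset.mem_filter, Finset.mem_powerset]
        refine ⟨⟨Finset.sdiff_subset_sdiff hB.1 (Finset.Subset.refl _), ?_⟩,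
          Finset.inter_subset_inter_right hB.1, ?_⟩
        · intro z hz hh
          apply hB.2 z (Finset.mem_insert_of_mem hz)
          have hsub : F ∪ B \ {x, k - x} ⊆ F ∪ B :=
            Finset.union_subset_union_right Finset.sdiff_subset
          exact ⟨hsub hh.1, hsub hh.2⟩
        · intro hh
          apply hB.2 x (Finset.mem_insert_self _ _)
          have hsub : F ∪ B ∩ {x, k - x} ⊆ F ∪ B :=
            Finset.union_subset_union_right Finset.inter_subset_left
          exact ⟨hsub hh.1, hsub hh.2⟩
      · intro B _ C _ h
        simp only [Prod.mk.injEq] at h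
        rw [← Finset.sdiff_union_inter B {x, k - x}, h.1, h.2, Finset.sdiff_union_inter]
    rw [Finset.card_product] at hinj
    rw [hcard, pow_add, pow_succ, pow_succ]
    calc _ ≤ 4 ^ P.card * 4 * (_ * _) := Nat.mul_le_mul_left _ hinj
      _ = (4 ^ P.card * _) * (4 * _) := by ring
      _ ≤ _ := Nat.mul_le_mul ih' h1
      _ = _ := by ring

/-- The fixed part of the sets. -/
noncomputable def fixedPart (n : ℤ) : Finset ℤ :=
  {0, 1, 2, 3, 6, 10} ∪ Finset.Ico 14 34 ∪ Finset.Ico (n - 34) (n - 14) ∪ {n - 1}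

lemma mem_fixedPart (n z : ℤ) : z ∈ fixedPart n ↔
    (z = 0 ∨ z = 1 ∨ z = 2 ∨ z = 3 ∨ z = 6 ∨ z = 10) ∨ (14 ≤ z ∧ z < 34) ∨
      (n - 34 ≤ z ∧ z < n - 14) ∨ z = n - 1 := by
  simp only [fixedPart, Finset.mem_union, Finset.mem_insert, Finset.mem_singleton, Finset.mem_Ico]
  tauto

lemma diff_card (n : ℤ) (hn : 81 ≤ n) (A : Finset ℤ)
    (hA : ∀ a ∈ A, (a = 0 ∨ a = 1 ∨ a = 2 ∨ a = 3 ∨ a = 6 ∨ a = 10) ∨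
      (14 ≤ a ∧ a < n - 14) ∨ a = n - 1) : ((A - A).card : ℤ) ≤ 2 * n - 17 := by
  let J : Finset ℤ := {4, 5, 7, 8, 9, 11, 12, 13}
  have hJ : ∀ j, j ∈ J ↔ j = 4 ∨ j = 5 ∨ j = 7 ∨ j = 8 ∨ j = 9 ∨ j = 11 ∨ j = 12 ∨ j = 13 := by
    intro j; simp [J]
  let T1 := J.image (fun j => n - 1 - j)
  let T2 := J.image (fun j => j - (n - 1))
  have hT1 : T1.card = 8 := by
    rw [Finset.card_image_of_injective _ (by intro a b h; simp only at h; omega)]; rfl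
  have hT2 : T2.card = 8 := by
    rw [Finset.card_image_of_injective _ (by intro a b h; simp only at h; omega)]; rfl
  have hm1 : ∀ z, z ∈ T1 ↔ n - 1 - z ∈ J := by
    intro z
    simp only [T1, Finset.mem_image]
    constructor
    · rintro ⟨j, hj, rfl⟩; simpa using hj
    · intro h; exact ⟨_, h, by ring⟩
  have hm2 : ∀ z, z ∈ T2 ↔ n - 1 + z ∈ J := by
    intro z
    simp only [T2, Finset.mem_image]
    constructor
    · rintro ⟨j, hj, rfl⟩; simpa using hj
    · intro h; exact ⟨_, h, by ring⟩
  have hdis : Disjoint T1 T2 := by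
    rw [Finset.disjoint_left]
    intro z h1 h2
    rw [hm1, hJ] at h1
    rw [hm2, hJ] at h2
    omega
  have hsub : (A - A) ∪ (T1 ∪ T2) ⊆ Finset.Icc (-(n - 1)) (n - 1) := by
    intro z hz
    simp only [Finset.mem_union, hm1, hm2, hJ, Finset.mem_sub] at hz
    rw [Finset.mem_Icc]
    rcases hz with ⟨a, ha, b, hb, rfl⟩ | h | h
    · have := hA a ha
      have := hA b hb
      omega
    · omega
    · omega
  have hd : Disjoint (A - A) (T1 ∪ T2) := by
    rw [Finset.disjoint_left]
    intro z hz h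
    simp only [Finset.mem_union, hm1, hm2, hJ] at h
    obtain ⟨a, ha, b, hb, rfl⟩ := Finset.mem_sub.1 hz
    have h1 := hA a ha
    have h2 := hA b hb
    omega
  have hc := Finset.card_le_card hsub
  rw [Finset.card_union_of_disjoint hd, Finset.card_union_of_disjoint hdis, hT1, hT2,
    Int.card_Icc] at hc
  omega

lemma sum_card (n : ℤ) (hn : 81 ≤ n) (A : Finset ℤ) (hF : fixedPart n ⊆ A)
    (hA : ∀ k, 66 ≤ k → k ≤ 2 * n - 68 → k ∈ restSum A) :
    2 * n - 16 ≤ ((restSum A).card : ℤ) := by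
  have key : ∀ k x, (x ∈ fixedPart n) → (k - x ∈ fixedPart n) → 2 * x ≠ k → k ∈ restSum A :=
    fun k x h1 h2 h3 => mem_restSum (hF h1) (hF h2) h3
  have hsub : Finset.Icc 1 (2 * n - 16) ⊆ restSum A := by
    intro k hk
    rw [Finset.mem_Icc] at hk
    obtain ⟨hk1, hk2⟩ := hk
    by_cases h1 : k ≤ 65
    · by_cases h2 : k ≤ 13
      · have h : k = 1 ∨ k = 2 ∨ k = 3 ∨ k = 4 ∨ k = 5 ∨ k = 6 ∨ k = 7 ∨ k = 8 ∨ k = 9 ∨ k = 10 ∨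
          k = 11 ∨ k = 12 ∨ k = 13 := by omega
        simp only [mem_fixedPart] at key
        rcases h with h | h | h | h | h | h | h | h | h | h | h | h | h
        · exact key k 0 (by omega) (by omega) (by omega)
        · exact key k 0 (by omega) (by omega) (by omega)
        · exact key k 0 (by omega) (by omega) (by omega)
        · exact key k 1 (by omega) (by omega) (by omega)
        · exact key k 2 (by omega) (by omega) (by omega)
        · exact key k 0 (by omega) (by omega) (by omega)
        · exact key k 1 (by omega) (by omega) (by omega)
        · exact key k 2 (by omega) (by omega) (by omega)
        · exact key k 3 (by omega) (by omega) (by omega)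
        · exact key k 0 (by omega) (by omega) (by omega)
        · exact key k 1 (by omega) (by omega) (by omega)
        · exact key k 2 (by omega) (by omega) (by omega)
        · exact key k 3 (by omega) (by omega) (by omega)
      · simp only [mem_fixedPart] at key
        by_cases h3 : k < 34
        · exact key k 0 (by omega) (by omega) (by omega)
        · by_cases h4 : k ≤ 47
          · exact key k 14 (by omega) (by omega) (by omega)
          · exact key k 33 (by omega) (by omega) (by omega)
    · by_cases h2 : k ≤ 2 * n - 68
      · exact hA k (by omega) h2
      · simp only [mem_fixedPart] at key
        by_cases h3 : 2 * n - 35 ≤ k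
        · exact key k (n - 1) (by omega) (by omega) (by omega)
        · by_cases h4 : 2 * n - 49 ≤ k
          · exact key k (n - 15) (by omega) (by omega) (by omega)
          · exact key k (n - 34) (by omega) (by omega) (by omega)
  have hc := Finset.card_le_card hsub
  rw [Int.card_Icc] at hc
  omega

/-- Middle sets for which `k` is not a restricted sum. -/
noncomputable def badSet (n k : ℤ) : Finset (Finset ℤ) :=
  (Finset.Ico 34 (n - 34)).powerset.filter (fun B => k ∉ restSum (fixedPart n ∪ B))

lemma badSet_card (n k lo : ℤ) (p : ℕ) (hlo : 14 ≤ lo) (hp : 2 * (lo + p - 1) < k)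
    (hk : k - lo ≤ n - 15) :
    4 ^ p * (badSet n k).card ≤ 3 ^ p * 2 ^ (Finset.Ico 34 (n - 34)).card := by
  have h := pair_count (fixedPart n) k (Finset.Ico lo (lo + p)) (Finset.Ico 34 (n - 34)) (by
    intro x hx
    rw [Finset.mem_Ico] at hx
    simp only [Finset.mem_union, mem_fixedPart, Finset.mem_Ico]
    refine ⟨?_, ?_, ?_⟩ <;> omega)
  have hc : (Finset.Ico lo (lo + p)).card = p := by simp
  rw [hc] at h
  refine le_trans (Nat.mul_le_mul_left _ (Finset.card_le_card ?_)) h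
  intro B hB
  rw [badSet, Finset.mem_filter] at hB
  rw [Finset.mem_filter]
  refine ⟨hB.1, ?_⟩
  intro x hx hh
  rw [Finset.mem_Ico] at hx
  exact hB.2 (mem_restSum hh.1 hh.2 (by omega))

lemma badSet_card' (n k lo : ℤ) (j : ℕ) (hlo : 14 ≤ lo)
    (hp : 2 * (lo + (19 + (j + 1) / 2 : ℕ) - 1) < k) (hk : k - lo ≤ n - 15) :
    ((badSet n k).card : ℚ) ≤
      2 ^ (Finset.Ico 34 (n - 34)).card * ((3 / 4) ^ 19 * (7 / 8) ^ j) := by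
  have h := badSet_card n k lo (19 + (j + 1) / 2) hlo hp hk
  set p := 19 + (j + 1) / 2 with hpdef
  have h' : (4 : ℚ) ^ p * (badSet n k).card ≤ 3 ^ p * 2 ^ (Finset.Ico 34 (n - 34)).card := by
    exact_mod_cast h
  have h1 : ((badSet n k).card : ℚ) ≤ 2 ^ (Finset.Ico 34 (n - 34)).card * (3 / 4) ^ p := by
    rw [div_pow, ← mul_div_assoc, le_div_iff₀ (by positivity)]
    linarith
  refine le_trans h1 (mul_le_mul_of_nonneg_left ?_ (by positivity))
  rw [hpdef, pow_add]
  refine mul_le_mul_of_nonneg_left ?_ (by positivity)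
  calc (3 / 4 : ℚ) ^ ((j + 1) / 2) ≤ (49 / 64) ^ ((j + 1) / 2) :=
        pow_le_pow_left₀ (by norm_num) (by norm_num) _
    _ = (7 / 8) ^ (2 * ((j + 1) / 2)) := by rw [pow_mul]; norm_num
    _ ≤ (7 / 8) ^ j := pow_le_pow_of_le_one (by norm_num) (by norm_num) (by omega)

lemma geom_bound (N : ℕ) : ∑ j ∈ Finset.range N, (7 / 8 : ℚ) ^ j ≤ 8 := by
  have h : ∑ j ∈ Finset.range N, (7 / 8 : ℚ) ^ j = 8 - 8 * (7 / 8) ^ N := by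
    induction N with
    | zero => simp
    | succ N ih => rw [Finset.sum_range_succ, ih]; ring
  rw [h]
  have : (0 : ℚ) ≤ (7 / 8) ^ N := by positivity
  linarith

theorem rsd_proportion (n : ℕ) (hn : 81 ≤ n) :
    (4135 : ℚ) / 10 ^ 28 * 2 ^ n ≤
      (((Finset.Icc (0 : ℤ) ((n : ℤ) - 1)).powerset.filter
        (fun A => (A - A).card < (restSum A).card)).card : ℚ) := by
  obtain ⟨m, rfl⟩ : ∃ m, n = m + 68 := ⟨n - 68, by omega⟩
  set N : ℤ := ((m + 68 : ℕ) : ℤ) with hN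
  have hN' : N = m + 68 := by rw [hN]; push_cast; ring
  have hMc : (Finset.Ico 34 (N - 34)).card = m := by rw [Int.card_Ico]; omega
  let bad : Finset (Finset ℤ) := (Finset.range (m + 2)).biUnion
    (fun j => badSet N (66 + j) ∪ badSet N (2 * N - 68 - j))
  have hbad : (bad.card : ℚ) ≤ 2 ^ m / 2 := by
    calc (bad.card : ℚ) ≤ ∑ j ∈ Finset.range (m + 2),
          (2 * (2 ^ m * ((3 / 4) ^ 19 * (7 / 8) ^ j)) : ℚ) := by
          have h1 : bad.card ≤ _ := Finset.card_biUnion_le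
          refine le_trans (Nat.cast_le.2 h1) ?_
          rw [Nat.cast_sum]
          apply Finset.sum_le_sum
          intro j hj
          rw [Finset.mem_range] at hj
          refine le_trans (Nat.cast_le.2 (Finset.card_union_le _ _)) ?_
          push_cast
          have a1 := badSet_card' N (66 + j) 14 j (by omega) (by omega) (by omega)
          have a2 := badSet_card' N (2 * N - 68 - j) (N - 53 - j) j (by omega) (by omega) (by omega)
          rw [hMc] at a1 a2
          linarith
      _ = 2 * 2 ^ m * (3 / 4) ^ 19 * ∑ j ∈ Finset.range (m + 2), (7 / 8 : ℚ) ^ j := by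
          rw [Finset.mul_sum]
          apply Finset.sum_congr rfl
          intro j _
          ring
      _ ≤ 2 * 2 ^ m * (3 / 4) ^ 19 * 8 :=
          mul_le_mul_of_nonneg_left (geom_bound _) (by positivity)
      _ = 2 ^ m * (16 * (3 / 4) ^ 19) := by ring
      _ ≤ 2 ^ m * (1 / 2) := mul_le_mul_of_nonneg_left (by norm_num) (by positivity)
      _ = 2 ^ m / 2 := by ring
  let good := (Finset.Ico 34 (N - 34)).powerset \ bad
  have hgood : (2 : ℚ) ^ m / 2 ≤ good.card := by
    have h : (Finset.Ico 34 (N - 34)).powerset.card - bad.card ≤ good.card :=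
      Finset.le_card_sdiff _ _
    rw [Finset.card_powerset, hMc] at h
    have h2 : 2 ^ m ≤ good.card + bad.card := by omega
    have h3 : (2 : ℚ) ^ m ≤ good.card + bad.card := by exact_mod_cast h2
    linarith
  have hle : good.card ≤ ((Finset.Icc (0 : ℤ) (N - 1)).powerset.filter
        (fun A => (A - A).card < (restSum A).card)).card := by
    apply Finset.card_le_card_of_injOn (fun B => fixedPart N ∪ B)
    · intro B hB
      simp only [good, Finset.mem_coe, Finset.mem_sdiff, Finset.mem_powerset] at hB
      obtain ⟨hB1, hB2⟩ := hB
      have hmem : ∀ a ∈ fixedPart N ∪ B,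
          (a = 0 ∨ a = 1 ∨ a = 2 ∨ a = 3 ∨ a = 6 ∨ a = 10) ∨
          (14 ≤ a ∧ a < N - 14) ∨ a = N - 1 := by
        intro a ha
        rcases Finset.mem_union.1 ha with h | h
        · rw [mem_fixedPart] at h
          omega
        · have := Finset.mem_Ico.1 (hB1 h)
          omega
      simp only [Finset.mem_coe, Finset.mem_filter, Finset.mem_powerset]
      constructor
      · intro a ha
        have := hmem a ha
        rw [Finset.mem_Icc]
        omega
      · have h1 := diff_card N (by omega) _ hmem
        have h2 := sum_card N (by omega) (fixedPart N ∪ B) Finset.subset_union_left (by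
          intro k hk1 hk2
          by_contra hcon
          apply hB2
          have hmb : B ∈ badSet N k := by
            rw [badSet, Finset.mem_filter, Finset.mem_powerset]
            exact ⟨hB1, hcon⟩
          simp only [bad, Finset.mem_biUnion, Finset.mem_union, Finset.mem_range]
          by_cases hk : k ≤ N - 1
          · refine ⟨(k - 66).toNat, by omega, Or.inl ?_⟩
            rwa [show (66 : ℤ) + ((k - 66).toNat : ℤ) = k by omega]
          · refine ⟨(2 * N - 68 - k).toNat, by omega, Or.inr ?_⟩
            rwa [show 2 * N - 68 - ((2 * N - 68 - k).toNat : ℤ) = k by omega])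
        omega
    · intro B hB C hC h
      have hrec : ∀ D ∈ good, (fixedPart N ∪ D).filter (fun z => 34 ≤ z ∧ z < N - 34) = D := by
        intro D hD
        simp only [good, Finset.mem_sdiff, Finset.mem_powerset] at hD
        ext z
        rw [Finset.mem_filter, Finset.mem_union, mem_fixedPart]
        constructor
        · rintro ⟨h | h, h'⟩
          · omega
          · exact h
        · intro hz
          exact ⟨Or.inr hz, Finset.mem_Ico.1 (hD.1 hz)⟩
      rw [← hrec B hB, ← hrec C hC]
      simp only at h
      rw [h]
  calc (4135 : ℚ) / 10 ^ 28 * 2 ^ (m + 68) = 2 ^ m * (4135 / 10 ^ 28 * 2 ^ 68) := by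
        rw [pow_add]; ring
    _ ≤ 2 ^ m * (1 / 2) := mul_le_mul_of_nonneg_left (by norm_num) (by positivity)
    _ = 2 ^ m / 2 := by ring
    _ ≤ good.card := hgood
    _ ≤ _ := by exact_mod_cast hle
end

section
/- There are no RSD subsets of {0,1,…,29}: every subset A of {0,1,…,29} satisfies |A+̂A| ≤ |A−A|. -/
open Pointwise

/-! Bit-sliced exhaustive search: a natural number is read as a vector of truth values,
one per lane, and each lane stands for one candidate set. -/

/-- Entrywise bitwise or of two lists, the longer tail being kept. -/
def zipOr : List ℕ → List ℕ → List ℕ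
  | [], ys => ys
  | x :: xs, [] => x :: xs
  | x :: xs, y :: ys => Nat.lor x y :: zipOr xs ys

/-- Entrywise bitwise and with a fixed mask. -/
def mapAnd (v : ℕ) : List ℕ → List ℕ
  | [] => []
  | x :: xs => Nat.land v x :: mapAnd v xs

/-- One layer of carry-save addition; the carries are handed to `f`. -/
def csaPass (f : List ℕ → List ℕ) : List ℕ → ℕ → List ℕ → List ℕ
  | [], s, cs => s :: f cs
  | [a], s, cs => Nat.xor s a :: f (Nat.land s a :: cs)
  | a :: b :: r, s, cs =>
    csaPass f r (Nat.xor s (Nat.xor a b))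
      (Nat.xor a (Nat.land (Nat.xor a b) (Nat.xor a s)) :: cs)

/-- Bit-sliced population count with `k` output digits. -/
def bitCount : ℕ → List ℕ → List ℕ
  | 0, _ => []
  | k + 1, L => csaPass (bitCount k) L 0 []

/-- Bit-sliced comparison, least significant digit first. -/
def gtMask : List ℕ → List ℕ → ℕ → ℕ
  | a :: as, b :: bs, acc =>
    gtMask as bs (Nat.xor acc (Nat.land (Nat.xor a b) (Nat.xor a acc)))
  | _, _, acc => acc

/-- No lane has more than `2 * #D + 1` sums. -/
def leafOk (S D : List ℕ) : Bool :=
  Nat.beq (gtMask (bitCount 6 S).tail (bitCount 5 D) 0) 0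

/-- Go through all choices for the remaining `r` elements. -/
def chk (ones : ℕ) : ℕ → List ℕ → List ℕ → List ℕ → Bool
  | 0, _, S, D => leafOk S D
  | r + 1, X, S, D =>
    and (chk ones r (0 :: X) (0 :: 0 :: S) D)
      (chk ones r (ones :: X) (zipOr (0 :: 0 :: S) X) (zipOr D X))

/-- Truth tables of `t` independent variables. -/
def vars : ℕ → List ℕ
  | 0 => []
  | t + 1 => Nat.shiftLeft (Nat.pow 2 (Nat.pow 2 t) - 1) (Nat.pow 2 t) ::
      (vars t).map (fun p => Nat.lor p (Nat.shiftLeft p (Nat.pow 2 t)))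

/-- Follow the given choices for the next elements, then go through all choices for the rest. -/
def runB (ones r : ℕ) : List Bool → List ℕ → List ℕ → List ℕ → Bool
  | [], X, S, D => chk ones r X S D
  | b :: bs, X, S, D =>
    cond b (runB ones r bs (ones :: X) (zipOr (0 :: 0 :: S) X) (zipOr D X))
      (runB ones r bs (0 :: X) (0 :: 0 :: S) D)

/-- Add the elements given by a list of masks, then proceed as in `runB`. -/
def runV (ones r : ℕ) (bs : List Bool) : List ℕ → List ℕ → List ℕ → List ℕ → Bool
  | [], X, S, D => runB ones r bs X S D
  | v :: vs, X, S, D =>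
    runV ones r bs vs (v :: X) (zipOr (0 :: 0 :: S) (mapAnd v X)) (zipOr D (mapAnd v X))

def allOnes (t : ℕ) : ℕ := Nat.pow 2 (Nat.pow 2 t) - 1

/-- All sets containing `0` whose first `t` further elements are free (one lane each), whose next
elements are given by `bs`, and whose last `r` elements are free. -/
def job (t r : ℕ) (bs : List Bool) : Bool :=
  runV (allOnes t) r bs (vars t) [allOnes t] [] []

/-! Correctness of the search, lane by lane. -/

theorem zipOr_getD (A B : List ℕ) (p : ℕ) :
    (zipOr A B).getD p 0 = A.getD p 0 ||| B.getD p 0 := by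
  induction A generalizing B p with
  | nil => simp [zipOr]
  | cons x xs ih =>
    cases B with
    | nil => simp [zipOr]
    | cons y ys =>
      cases p with
      | zero => rfl
      | succ p => simpa [zipOr] using ih ys p

theorem zipOr_length (A B : List ℕ) : (zipOr A B).length = max A.length B.length := by
  induction A generalizing B with
  | nil => simp [zipOr]
  | cons x xs ih =>
    cases B with
    | nil => simp [zipOr]
    | cons y ys => simp [zipOr, ih]

theorem mapAnd_getD (v : ℕ) (A : List ℕ) (p : ℕ) :
    (mapAnd v A).getD p 0 = v &&& A.getD p 0 := by
  induction A generalizing p with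
  | nil => simp [mapAnd]
  | cons x xs ih =>
    cases p with
    | zero => rfl
    | succ p => simpa [mapAnd] using ih p

theorem mapAnd_length (v : ℕ) (A : List ℕ) : (mapAnd v A).length = A.length := by
  induction A with
  | nil => simp [mapAnd]
  | cons x xs ih => simp [mapAnd, ih]

/-- Number of masks in the list containing lane `i`. -/
def laneSum (i : ℕ) : List ℕ → ℕ
  | [] => 0
  | x :: xs => (x.testBit i).toNat + laneSum i xs

/-- Value in lane `i` of a list of digits. -/
def laneVal (i : ℕ) : List ℕ → ℕ
  | [] => 0
  | x :: xs => (x.testBit i).toNat + 2 * laneVal i xs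

theorem nat_xor_eq (a b : ℕ) : Nat.xor a b = a ^^^ b := rfl
theorem nat_land_eq (a b : ℕ) : Nat.land a b = a &&& b := rfl
theorem nat_lor_eq (a b : ℕ) : Nat.lor a b = a ||| b := rfl

theorem laneSum_le (i : ℕ) (L : List ℕ) : laneSum i L ≤ L.length := by
  induction L with
  | nil => simp [laneSum]
  | cons x xs ih =>
    have := Bool.toNat_le (x.testBit i)
    simp only [laneSum, List.length_cons]
    omega

theorem csaPass_val (i k : ℕ) (f : List ℕ → List ℕ)
    (hf : ∀ L : List ℕ, laneSum i L < 2 ^ k → laneVal i (f L) = laneSum i L)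
    (L : List ℕ) (s : ℕ) (cs : List ℕ)
    (h : laneSum i L + (s.testBit i).toNat + 2 * laneSum i cs < 2 ^ (k + 1)) :
    laneVal i (csaPass f L s cs) = laneSum i L + (s.testBit i).toNat + 2 * laneSum i cs := by
  fun_induction csaPass f L s cs with
  | case1 s cs =>
    have : laneSum i cs < 2 ^ k := by rw [pow_succ] at h; omega
    simp [laneVal, laneSum, hf cs this]
  | case2 a s cs =>
    have e : laneSum i [a] + (s.testBit i).toNat + 2 * laneSum i cs =
        ((Nat.xor s a).testBit i).toNat + 2 * laneSum i (Nat.land s a :: cs) := by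
      simp only [laneSum, nat_xor_eq, nat_land_eq, Nat.testBit_xor, Nat.testBit_and]
      cases s.testBit i <;> cases a.testBit i <;> simp <;> omega
    rw [e] at h ⊢
    rw [laneVal, hf _ (by rw [pow_succ] at h; omega)]
  | case3 a b r s cs ih =>
    have e : laneSum i (a :: b :: r) + (s.testBit i).toNat + 2 * laneSum i cs =
        laneSum i r + ((Nat.xor s (Nat.xor a b)).testBit i).toNat + 2 * laneSum i
          (Nat.xor a (Nat.land (Nat.xor a b) (Nat.xor a s)) :: cs) := by
      simp only [laneSum, nat_xor_eq, nat_land_eq, Nat.testBit_xor, Nat.testBit_and]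
      cases s.testBit i <;> cases a.testBit i <;> cases b.testBit i <;> simp <;> omega
    rw [e] at h ⊢
    exact ih h

theorem bitCount_val (i k : ℕ) (L : List ℕ) (h : laneSum i L < 2 ^ k) :
    laneVal i (bitCount k L) = laneSum i L := by
  induction k generalizing L with
  | zero => simp only [bitCount, laneVal]; omega
  | succ k ih =>
    rw [bitCount, csaPass_val i k _ ih _ _ _ (by simpa [laneSum] using h)]
    simp [laneSum]

theorem csaPass_length (k : ℕ) (f : List ℕ → List ℕ) (hf : ∀ L, (f L).length = k)
    (L : List ℕ) (s : ℕ) (cs : List ℕ) : (csaPass f L s cs).length = k + 1 := by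
  fun_induction csaPass f L s cs with
  | case1 s cs => simp [hf]
  | case2 a s cs => simp [hf]
  | case3 a b r s cs ih => exact ih

theorem bitCount_length (k : ℕ) (L : List ℕ) : (bitCount k L).length = k := by
  induction k generalizing L with
  | zero => rfl
  | succ k ih => exact csaPass_length k _ ih _ _ _

theorem gtMask_spec (i : ℕ) (as bs : List ℕ) (acc : ℕ) (hl : as.length = bs.length) :
    (gtMask as bs acc).testBit i = true ↔
      laneVal i bs < laneVal i as + (acc.testBit i).toNat := by
  induction as generalizing bs acc with
  | nil =>
    have : bs = [] := by rw [← List.length_eq_zero_iff]; simpa using hl.symm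
    subst this
    cases h : acc.testBit i <;> simp [gtMask, laneVal, h]
  | cons a as ih =>
    cases bs with
    | nil => simp at hl
    | cons b bs =>
      rw [gtMask, ih _ _ (by simpa using hl)]
      simp only [laneVal, nat_xor_eq, nat_land_eq, Nat.testBit_xor, Nat.testBit_and]
      cases acc.testBit i <;> cases a.testBit i <;> cases b.testBit i <;> simp <;> omega

theorem leafOk_spec (i : ℕ) (S D : List ℕ) (hS : S.length < 64) (hD : D.length < 32)
    (h : leafOk S D = true) : laneSum i S ≤ 2 * laneSum i D + 1 := by
  have h0 : gtMask (bitCount 6 S).tail (bitCount 5 D) 0 = 0 := Nat.eq_of_beq_eq_true h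
  have hg := gtMask_spec i (bitCount 6 S).tail (bitCount 5 D) 0
    (by simp [bitCount_length])
  rw [h0, bitCount_val i 5 D ((laneSum_le i D).trans_lt hD)] at hg
  have hs := bitCount_val i 6 S ((laneSum_le i S).trans_lt hS)
  have hl := bitCount_length 6 S
  generalize bitCount 6 S = B at *
  cases B with
  | nil => simp at hl
  | cons x B =>
    simp only [laneVal] at hs
    simp at hg
    have := Bool.toNat_le (x.testBit i)
    omega

/-- The state describes the set `{j < e | a j}` in lane `i`. -/
structure LaneInv (i : ℕ) (a : ℕ → Bool) (e : ℕ) (X S D : List ℕ) : Prop where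
  hX : ∀ p, (X.getD p 0).testBit i = true ↔ ∃ j, j + p + 1 = e ∧ a j = true
  hS : ∀ p, (S.getD p 0).testBit i = true ↔
    ∃ u v, u < v ∧ v < e ∧ a u = true ∧ a v = true ∧ u + v + p + 3 = 2 * e
  hD : ∀ p, (D.getD p 0).testBit i = true ↔
    ∃ u v, u < v ∧ v < e ∧ a u = true ∧ a v = true ∧ v = u + p + 1
  lX : X.length = e
  lS : S.length + 2 = 2 * e
  lD : D.length < e

theorem LaneInv.skip {i : ℕ} {a : ℕ → Bool} {e : ℕ} {X S D : List ℕ} (h : LaneInv i a e X S D)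
    (ha : a e = false) : LaneInv i a (e + 1) (0 :: X) (0 :: 0 :: S) D where
  hX p := by
    cases p with
    | zero => simpa using ha
    | succ p =>
      simp only [List.getD_cons_succ, h.hX]
      constructor <;> rintro ⟨j, h1, h2⟩ <;> exact ⟨j, by omega, h2⟩
  hS p := by
    have key : (((0 :: 0 :: S).getD p 0).testBit i = true) ↔
        ∃ u v, u < v ∧ v < e ∧ a u = true ∧ a v = true ∧ u + v + p + 3 = 2 * (e + 1) := by
      rcases p with _ | _ | p
      · simp; intros; omega
      · simp; intros; omega
      · simp only [List.getD_cons_succ, h.hS]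
        constructor <;> rintro ⟨u, v, h1, h2, h3, h4, h5⟩ <;>
          exact ⟨u, v, h1, h2, h3, h4, by omega⟩
    rw [key]
    constructor
    · rintro ⟨u, v, h1, h2, h3, h4, h5⟩
      exact ⟨u, v, h1, by omega, h3, h4, h5⟩
    · rintro ⟨u, v, h1, h2, h3, h4, h5⟩
      have : v ≠ e := by rintro rfl; simp [ha] at h4
      exact ⟨u, v, h1, by omega, h3, h4, h5⟩
  hD p := by
    rw [h.hD]
    constructor
    · rintro ⟨u, v, h1, h2, h3, h4, h5⟩
      exact ⟨u, v, h1, by omega, h3, h4, h5⟩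
    · rintro ⟨u, v, h1, h2, h3, h4, h5⟩
      have : v ≠ e := by rintro rfl; simp [ha] at h4
      exact ⟨u, v, h1, by omega, h3, h4, h5⟩
  lX := by simp [h.lX]
  lS := by have := h.lS; simp only [List.length_cons]; omega
  lD := by have := h.lD; omega

theorem LaneInv.step {i : ℕ} {a : ℕ → Bool} {e : ℕ} {X S D Y : List ℕ} {v : ℕ}
    (h : LaneInv i a e X S D) (hv : v.testBit i = a e)
    (hY : ∀ p, (Y.getD p 0).testBit i = (a e && (X.getD p 0).testBit i))
    (lY : Y.length = X.length) :
    LaneInv i a (e + 1) (v :: X) (zipOr (0 :: 0 :: S) Y) (zipOr D Y) := by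
  have lX := h.lX
  have lS := h.lS
  have lD := h.lD
  cases ha : a e with
  | false =>
    have hs := h.skip ha
    have hY0 : ∀ p, (Y.getD p 0).testBit i = false := by intro p; rw [hY, ha]; rfl
    refine ⟨?_, ?_, ?_, ?_, ?_, ?_⟩
    · intro p
      rw [← hs.hX p]
      cases p with
      | zero => simp [hv, ha]
      | succ p => simp
    · intro p
      rw [zipOr_getD, Nat.testBit_or, hY0, Bool.or_false, hs.hS]
    · intro p
      rw [zipOr_getD, Nat.testBit_or, hY0, Bool.or_false, hs.hD]
    · simp [lX]
    · rw [zipOr_length]; simp only [List.length_cons]; omega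
    · rw [zipOr_length]; omega
  | true =>
    refine ⟨?_, ?_, ?_, ?_, ?_, ?_⟩
    · intro p
      cases p with
      | zero => simp [hv, ha]
      | succ p =>
        simp only [List.getD_cons_succ, h.hX]
        constructor <;> rintro ⟨j, h1, h2⟩ <;> exact ⟨j, by omega, h2⟩
    · intro p
      have key : (((0 :: 0 :: S).getD p 0).testBit i = true) ↔
          ∃ u v, u < v ∧ v < e ∧ a u = true ∧ a v = true ∧ u + v + p + 3 = 2 * (e + 1) := by
        rcases p with _ | _ | p
        · simp; intros; omega
        · simp; intros; omega
        · simp only [List.getD_cons_succ, h.hS]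
          constructor <;> rintro ⟨u, v, h1, h2, h3, h4, h5⟩ <;>
            exact ⟨u, v, h1, h2, h3, h4, by omega⟩
      rw [zipOr_getD, Nat.testBit_or, hY, ha, Bool.true_and, Bool.or_eq_true, key, h.hX]
      constructor
      · rintro (⟨u, v, h1, h2, h3, h4, h5⟩ | ⟨j, h1, h2⟩)
        · exact ⟨u, v, h1, by omega, h3, h4, h5⟩
        · exact ⟨j, e, by omega, by omega, h2, ha, by omega⟩
      · rintro ⟨u, v, h1, h2, h3, h4, h5⟩
        by_cases hve : v = e
        · exact Or.inr ⟨u, by omega, h3⟩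
        · exact Or.inl ⟨u, v, h1, by omega, h3, h4, h5⟩
    · intro p
      rw [zipOr_getD, Nat.testBit_or, hY, ha, Bool.true_and, Bool.or_eq_true, h.hD, h.hX]
      constructor
      · rintro (⟨u, v, h1, h2, h3, h4, h5⟩ | ⟨j, h1, h2⟩)
        · exact ⟨u, v, h1, by omega, h3, h4, h5⟩
        · exact ⟨j, e, by omega, by omega, h2, ha, by omega⟩
      · rintro ⟨u, v, h1, h2, h3, h4, h5⟩
        by_cases hve : v = e
        · exact Or.inr ⟨u, by omega, h3⟩
        · exact Or.inl ⟨u, v, h1, by omega, h3, h4, h5⟩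
    · simp [lX]
    · rw [zipOr_length]; simp only [List.length_cons]; omega
    · rw [zipOr_length]; omega

/-- What the search establishes for one lane. -/
def Good (i : ℕ) (a : ℕ → Bool) : Prop :=
  ∃ X S D, LaneInv i a 30 X S D ∧ laneSum i S ≤ 2 * laneSum i D + 1

theorem LaneInv.take {i : ℕ} {a : ℕ → Bool} {e : ℕ} {X S D : List ℕ} {ones : ℕ}
    (h : LaneInv i a e X S D) (he : 0 < e) (ho : ones.testBit i = true) (ha : a e = true) :
    LaneInv i a (e + 1) (ones :: X) (zipOr (0 :: 0 :: S) X) (zipOr D X) :=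
  h.step (by rw [ho, ha]) (by intro p; rw [ha, Bool.true_and]) rfl

theorem chk_spec {i : ℕ} {a : ℕ → Bool} {ones : ℕ} (ho : ones.testBit i = true) (r : ℕ) :
    ∀ (e : ℕ) (X S D : List ℕ), LaneInv i a e X S D → 0 < e → e + r = 30 →
      chk ones r X S D = true → Good i a := by
  induction r with
  | zero =>
    intro e X S D h he her hc
    obtain rfl : e = 30 := by omega
    have lS := h.lS
    have lD := h.lD
    exact ⟨X, S, D, h, leafOk_spec i S D (by omega) (by omega) hc⟩
  | succ r ih =>
    intro e X S D h he her hc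
    rw [chk, Bool.and_eq_true] at hc
    cases ha : a e with
    | false => exact ih _ _ _ _ (h.skip ha) (by omega) (by omega) hc.1
    | true => exact ih _ _ _ _ (h.take he ho ha) (by omega) (by omega) hc.2

theorem runB_spec {i : ℕ} {a : ℕ → Bool} {ones : ℕ} (ho : ones.testBit i = true) (r : ℕ)
    (bs : List Bool) : ∀ (e : ℕ) (X S D : List ℕ), LaneInv i a e X S D → 0 < e →
      e + bs.length + r = 30 → (∀ j (hj : j < bs.length), bs[j] = a (e + j)) →
      runB ones r bs X S D = true → Good i a := by
  induction bs with
  | nil =>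
    intro e X S D h he her _ hc
    exact chk_spec ho r e X S D h he (by simpa using her) hc
  | cons b bs ih =>
    intro e X S D h he her hb hc
    have hb0 : b = a e := hb 0 (by simp)
    have hb' : ∀ j (hj : j < bs.length), bs[j] = a (e + 1 + j) := by
      intro j hj
      have := hb (j + 1) (by simpa using hj)
      rw [show e + 1 + j = e + (j + 1) by omega]
      simpa using this
    simp only [List.length_cons] at her
    rw [runB] at hc
    cases ha : a e with
    | false =>
      rw [hb0, ha] at hc
      exact ih _ _ _ _ (h.skip ha) (by omega) (by omega) hb' hc
    | true =>
      rw [hb0, ha] at hc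
      exact ih _ _ _ _ (h.take he ho ha) (by omega) (by omega) hb' hc

theorem runV_spec {i : ℕ} {a : ℕ → Bool} {ones : ℕ} (ho : ones.testBit i = true) (r : ℕ)
    (bs : List Bool) (vs : List ℕ) : ∀ (e : ℕ) (X S D : List ℕ), LaneInv i a e X S D → 0 < e →
      e + vs.length + bs.length + r = 30 →
      (∀ j (hj : j < vs.length), vs[j].testBit i = a (e + j)) →
      (∀ j (hj : j < bs.length), bs[j] = a (e + vs.length + j)) →
      runV ones r bs vs X S D = true → Good i a := by
  induction vs with
  | nil =>
    intro e X S D h he her _ hb hc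
    exact runB_spec ho r bs e X S D h he (by simpa using her) (by simpa using hb) hc
  | cons v vs ih =>
    intro e X S D h he her hv hb hc
    have hv0 : v.testBit i = a e := hv 0 (by simp)
    simp only [List.length_cons] at her hb
    refine ih (e + 1) _ _ _ (h.step (Y := mapAnd v X) hv0 ?_ (mapAnd_length v X)) (by omega)
      (by omega) ?_ ?_ hc
    · intro p
      rw [mapAnd_getD, Nat.testBit_and, hv0]
    · intro j hj
      have := hv (j + 1) (by simpa using hj)
      rw [show e + 1 + j = e + (j + 1) by omega]
      simpa using this
    · intro j hj
      rw [hb j hj]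
      congr 1
      omega

theorem vars_length (t : ℕ) : (vars t).length = t := by
  induction t with
  | zero => rfl
  | succ t ih => simp [vars, ih]

theorem vars_lt (t : ℕ) : ∀ p ∈ vars t, p < 2 ^ 2 ^ t := by
  induction t with
  | zero => simp [vars]
  | succ t ih =>
    have e : 2 ^ 2 ^ (t + 1) = 2 ^ 2 ^ t * 2 ^ 2 ^ t := by rw [← pow_add]; congr 1; ring
    have hpos : 0 < 2 ^ 2 ^ t := by positivity
    have hsh : ∀ q, q < 2 ^ 2 ^ t → q <<< 2 ^ t < 2 ^ 2 ^ (t + 1) := by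
      intro q hq
      rw [e, Nat.shiftLeft_eq]
      exact Nat.mul_lt_mul_of_pos_right hq hpos
    intro p hp
    rw [vars, List.mem_cons, List.mem_map] at hp
    rcases hp with rfl | ⟨q, hq, rfl⟩
    · exact hsh _ (Nat.sub_lt hpos Nat.one_pos)
    · refine Nat.or_lt_two_pow (lt_of_lt_of_le (ih q hq) ?_) (hsh q (ih q hq))
      exact Nat.pow_le_pow_right (by norm_num) (Nat.pow_le_pow_right (by norm_num) (by omega))

theorem vars_spec (t : ℕ) : ∀ (a : ℕ → Bool), ∃ i < 2 ^ t,
    ∀ j (hj : j < (vars t).length), (vars t)[j].testBit i = a j := by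
  induction t with
  | zero => intro a; exact ⟨0, by norm_num, by intro j hj; simp [vars] at hj⟩
  | succ t ih =>
    intro a
    obtain ⟨i, hi, h⟩ := ih (fun j => a (j + 1))
    have hbig : ∀ p ∈ vars t, p.testBit (i + 2 ^ t) = false := by
      intro p hp
      exact Nat.testBit_lt_two_pow (lt_of_lt_of_le (vars_lt t p hp)
        (Nat.pow_le_pow_right (by norm_num) (by omega)))
    cases ha : a 0 with
    | false =>
      refine ⟨i, by rw [pow_succ]; omega, ?_⟩
      intro j hj
      cases j with
      | zero =>
        change (((2 ^ 2 ^ t - 1) <<< 2 ^ t).testBit i) = a 0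
        rw [ha, Nat.testBit_shiftLeft]
        simp [hi]
      | succ j =>
        have hj' : j < (vars t).length := by simpa [vars] using hj
        rw [← h j hj']
        simp only [vars, List.getElem_cons_succ, List.getElem_map]
        change ((vars t)[j] ||| (vars t)[j] <<< 2 ^ t).testBit i = _
        rw [Nat.testBit_or, Nat.testBit_shiftLeft]
        simp [hi]
    | true =>
      refine ⟨i + 2 ^ t, by rw [pow_succ]; omega, ?_⟩
      intro j hj
      cases j with
      | zero =>
        change (((2 ^ 2 ^ t - 1) <<< 2 ^ t).testBit (i + 2 ^ t)) = a 0
        rw [ha, Nat.testBit_shiftLeft, Nat.testBit_two_pow_sub_one]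
        simp [hi]
      | succ j =>
        have hj' : j < (vars t).length := by simpa [vars] using hj
        rw [← h j hj']
        simp only [vars, List.getElem_cons_succ, List.getElem_map]
        change ((vars t)[j] ||| (vars t)[j] <<< 2 ^ t).testBit (i + 2 ^ t) = _
        rw [Nat.testBit_or, Nat.testBit_shiftLeft, hbig _ (List.getElem_mem _)]
        simp

theorem job_spec (t r : ℕ) (bs : List Bool) (a : ℕ → Bool) (ht : 1 + t + bs.length + r = 30)
    (h0 : a 0 = true) (hb : ∀ j (hj : j < bs.length), bs[j] = a (1 + t + j))
    (h : job t r bs = true) : ∃ i, Good i a := by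
  obtain ⟨i, hi, hv⟩ := vars_spec t (fun j => a (1 + j))
  have ho : (allOnes t).testBit i = true := by
    change (2 ^ 2 ^ t - 1).testBit i = true
    rw [Nat.testBit_two_pow_sub_one]
    simpa using hi
  refine ⟨i, runV_spec ho r bs (vars t) 1 _ _ _ ?_ (by norm_num) (by rw [vars_length]; exact ht)
    hv (by rw [vars_length]; exact hb) h⟩
  refine ⟨?_, ?_, ?_, rfl, rfl, by simp⟩
  · intro p
    cases p with
    | zero => simp [ho, h0]
    | succ p => simp
  · intro p
    simp
  · intro p
    simp

theorem laneSum_eq (i : ℕ) (L : List ℕ) :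
    laneSum i L = ((Finset.range L.length).filter
      (fun p => (L.getD p 0).testBit i = true)).card := by
  induction L with
  | nil => simp [laneSum]
  | cons x xs ih =>
    rw [laneSum, ih, List.length_cons, Finset.card_filter, Finset.card_filter,
      Finset.sum_range_succ']
    simp only [List.getD_cons_succ, List.getD_cons_zero]
    cases x.testBit i <;> simp [add_comm]

theorem lt_length_of_testBit {i p : ℕ} {L : List ℕ} (h : (L.getD p 0).testBit i = true) :
    p < L.length := by
  by_contra hc
  rw [List.getD_eq_default _ _ (by omega)] at h
  simp at h

theorem good_card (A : Finset ℤ) (hA : A ⊆ Finset.Icc 0 29) (h0 : (0 : ℤ) ∈ A) (i : ℕ)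
    (h : Good i (fun j => decide ((j : ℤ) ∈ A))) : (restSum A).card ≤ (A - A).card := by
  obtain ⟨X, S, D, inv, hle⟩ := h
  have hS : (restSum A).card ≤ laneSum i S := by
    rw [laneSum_eq]
    refine le_trans (Finset.card_le_card (t := (((Finset.range S.length).filter
      (fun p => (S.getD p 0).testBit i = true)).image (fun p : ℕ => 57 - (p : ℤ)))) ?_)
      Finset.card_image_le
    have main : ∀ x ∈ A, ∀ y ∈ A, x < y → x + y ∈ ((Finset.range S.length).filter
        (fun p => (S.getD p 0).testBit i = true)).image (fun p : ℕ => 57 - (p : ℤ)) := by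
      intro x hx y hy hxy
      have bx := Finset.mem_Icc.1 (hA hx)
      have bY := Finset.mem_Icc.1 (hA hy)
      obtain ⟨u, rfl⟩ := Int.eq_ofNat_of_zero_le bx.1
      obtain ⟨v, rfl⟩ := Int.eq_ofNat_of_zero_le bY.1
      have ht : (S.getD (57 - (u + v)) 0).testBit i = true :=
        (inv.hS _).2 ⟨u, v, by omega, by omega, by simpa using hx, by simpa using hy, by omega⟩
      refine Finset.mem_image.2 ⟨57 - (u + v), Finset.mem_filter.2
        ⟨Finset.mem_range.2 (lt_length_of_testBit ht), ht⟩, by omega⟩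
    intro z hz
    simp only [restSum, Finset.mem_image, Finset.mem_filter, Finset.mem_product] at hz
    obtain ⟨⟨x, y⟩, ⟨⟨hx, hy⟩, hne⟩, rfl⟩ := hz
    rcases lt_or_gt_of_ne hne with hlt | hlt
    · exact main x hx y hy hlt
    · change x + y ∈ _
      rw [add_comm]
      exact main y hy x hx hlt
  have hD : 2 * laneSum i D + 1 ≤ (A - A).card := by
    rw [laneSum_eq]
    set F := (Finset.range D.length).filter (fun p => (D.getD p 0).testBit i = true) with hF
    have hmem : ∀ p ∈ F, ∃ u v : ℕ, (u : ℤ) ∈ A ∧ (v : ℤ) ∈ A ∧ v = u + p + 1 := by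
      intro p hp
      obtain ⟨u, v, -, -, h3, h4, h5⟩ := (inv.hD p).1 (Finset.mem_filter.1 hp).2
      exact ⟨u, v, by simpa using h3, by simpa using h4, h5⟩
    set P := F.image (fun p : ℕ => (p : ℤ) + 1) with hP
    set N := F.image (fun p : ℕ => -((p : ℤ) + 1)) with hN
    have cP : P.card = F.card := Finset.card_image_of_injective _ (fun p q h => by
      have h' : (p : ℤ) = q := by simpa using h
      exact_mod_cast h')
    have cN : N.card = F.card := Finset.card_image_of_injective _ (fun p q h => by
      have h' : (p : ℤ) = q := by simpa using h
      exact_mod_cast h')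
    have d1 : Disjoint P N := by
      rw [Finset.disjoint_left]
      intro z h1 h2
      obtain ⟨p, -, h3⟩ := Finset.mem_image.1 h1
      obtain ⟨q, -, h4⟩ := Finset.mem_image.1 h2
      omega
    have d2 : (0 : ℤ) ∉ P ∪ N := by
      intro hz
      rcases Finset.mem_union.1 hz with h1 | h1 <;>
      · obtain ⟨p, -, h3⟩ := Finset.mem_image.1 h1
        omega
    have hsub : insert 0 (P ∪ N) ⊆ A - A := by
      intro z hz
      rw [Finset.mem_insert, Finset.mem_union] at hz
      rw [Finset.mem_sub]
      rcases hz with rfl | h1 | h1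
      · exact ⟨0, h0, 0, h0, by norm_num⟩
      · obtain ⟨p, hp, rfl⟩ := Finset.mem_image.1 h1
        obtain ⟨u, v, hu, hv, e⟩ := hmem p hp
        exact ⟨v, hv, u, hu, by omega⟩
      · obtain ⟨p, hp, rfl⟩ := Finset.mem_image.1 h1
        obtain ⟨u, v, hu, hv, e⟩ := hmem p hp
        exact ⟨u, hu, v, hv, by omega⟩
    have := Finset.card_le_card hsub
    rw [Finset.card_insert_of_notMem d2, Finset.card_union_of_disjoint d1, cP, cN] at this
    omega
  omega

/-! The search itself, in 32 independent parts. -/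

theorem job_part_00 : job 20 4 [false, false, false, false, false] = true := by decide +kernel
theorem job_part_01 : job 20 4 [false, false, false, false, true] = true := by decide +kernel
theorem job_part_02 : job 20 4 [false, false, false, true, false] = true := by decide +kernel
theorem job_part_03 : job 20 4 [false, false, false, true, true] = true := by decide +kernel
theorem job_part_04 : job 20 4 [false, false, true, false, false] = true := by decide +kernel
theorem job_part_05 : job 20 4 [false, false, true, false, true] = true := by decide +kernel
theorem job_part_06 : job 20 4 [false, false, true, true, false] = true := by decide +kernel
theorem job_part_07 : job 20 4 [false, false, true, true, true] = true := by decide +kernel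
theorem job_part_08 : job 20 4 [false, true, false, false, false] = true := by decide +kernel
theorem job_part_09 : job 20 4 [false, true, false, false, true] = true := by decide +kernel
theorem job_part_10 : job 20 4 [false, true, false, true, false] = true := by decide +kernel
theorem job_part_11 : job 20 4 [false, true, false, true, true] = true := by decide +kernel
theorem job_part_12 : job 20 4 [false, true, true, false, false] = true := by decide +kernel
theorem job_part_13 : job 20 4 [false, true, true, false, true] = true := by decide +kernel
theorem job_part_14 : job 20 4 [false, true, true, true, false] = true := by decide +kernel
theorem job_part_15 : job 20 4 [false, true, true, true, true] = true := by decide +kernel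
theorem job_part_16 : job 20 4 [true, false, false, false, false] = true := by decide +kernel
theorem job_part_17 : job 20 4 [true, false, false, false, true] = true := by decide +kernel
theorem job_part_18 : job 20 4 [true, false, false, true, false] = true := by decide +kernel
theorem job_part_19 : job 20 4 [true, false, false, true, true] = true := by decide +kernel
theorem job_part_20 : job 20 4 [true, false, true, false, false] = true := by decide +kernel
theorem job_part_21 : job 20 4 [true, false, true, false, true] = true := by decide +kernel
theorem job_part_22 : job 20 4 [true, false, true, true, false] = true := by decide +kernel
theorem job_part_23 : job 20 4 [true, false, true, true, true] = true := by decide +kernel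
theorem job_part_24 : job 20 4 [true, true, false, false, false] = true := by decide +kernel
theorem job_part_25 : job 20 4 [true, true, false, false, true] = true := by decide +kernel
theorem job_part_26 : job 20 4 [true, true, false, true, false] = true := by decide +kernel
theorem job_part_27 : job 20 4 [true, true, false, true, true] = true := by decide +kernel
theorem job_part_28 : job 20 4 [true, true, true, false, false] = true := by decide +kernel
theorem job_part_29 : job 20 4 [true, true, true, false, true] = true := by decide +kernel
theorem job_part_30 : job 20 4 [true, true, true, true, false] = true := by decide +kernel
theorem job_part_31 : job 20 4 [true, true, true, true, true] = true := by decide +kernel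

theorem job_all (b₀ b₁ b₂ b₃ b₄ : Bool) : job 20 4 [b₀, b₁, b₂, b₃, b₄] = true := by
  cases b₀ <;> cases b₁ <;> cases b₂ <;> cases b₃ <;> cases b₄
  exacts [job_part_00, job_part_01, job_part_02, job_part_03, job_part_04,
    job_part_05, job_part_06, job_part_07, job_part_08, job_part_09,
    job_part_10, job_part_11, job_part_12, job_part_13, job_part_14,
    job_part_15, job_part_16, job_part_17, job_part_18, job_part_19,
    job_part_20, job_part_21, job_part_22, job_part_23, job_part_24,
    job_part_25, job_part_26, job_part_27, job_part_28, job_part_29,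
    job_part_30, job_part_31]

theorem card_le_of_zero_mem (A : Finset ℤ) (hA : A ⊆ Finset.Icc 0 29) (h0 : (0 : ℤ) ∈ A) :
    (restSum A).card ≤ (A - A).card := by
  have hbs := job_all (decide ((21 : ℤ) ∈ A)) (decide ((22 : ℤ) ∈ A)) (decide ((23 : ℤ) ∈ A))
    (decide ((24 : ℤ) ∈ A)) (decide ((25 : ℤ) ∈ A))
  obtain ⟨i, hi⟩ := job_spec 20 4 _ (fun j => decide ((j : ℤ) ∈ A)) rfl (by simpa using h0)
    (by
      intro j hj
      simp only [List.length_cons, List.length_nil] at hj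
      interval_cases j <;> rfl) hbs
  exact good_card A hA h0 i hi

theorem no_rsd_in_0_29 :
    ∀ A : Finset ℤ, A ⊆ Finset.Icc 0 29 → (restSum A).card ≤ (A - A).card := by
  intro A hA
  rcases A.eq_empty_or_nonempty with rfl | hne
  · simp [restSum]
  · set m := A.min' hne with hm
    have hmA : m ∈ A := A.min'_mem hne
    have hm0 := (Finset.mem_Icc.1 (hA hmA)).1
    set B := A.image (fun x => x - m) with hB
    have hinj : Function.Injective (fun x : ℤ => x - m) := fun x y h => by
      have h' : x - m = y - m := h
      omega
    have hBs : B ⊆ Finset.Icc 0 29 := by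
      intro z hz
      obtain ⟨x, hx, rfl⟩ := Finset.mem_image.1 hz
      have h1 := Finset.mem_Icc.1 (hA hx)
      have h2 : m ≤ x := A.min'_le x hx
      exact Finset.mem_Icc.2 ⟨by omega, by omega⟩
    have hB0 : (0 : ℤ) ∈ B := Finset.mem_image.2 ⟨m, hmA, by omega⟩
    have key := card_le_of_zero_mem B hBs hB0
    have hsum : (restSum A).card ≤ (restSum B).card := by
      refine Finset.card_le_card_of_injOn (fun z => z - 2 * m) ?_ (fun x _ y _ h => by
        have h' : x - 2 * m = y - 2 * m := h
        omega)
      intro z hz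
      simp only [restSum, Finset.coe_image, Finset.coe_filter, Finset.mem_product, Set.mem_image,
        Set.mem_ofPred_eq] at hz ⊢
      obtain ⟨⟨x, y⟩, ⟨⟨hx, hy⟩, hne⟩, rfl⟩ := hz
      refine ⟨(x - m, y - m), ⟨⟨Finset.mem_image_of_mem _ hx, Finset.mem_image_of_mem _ hy⟩, ?_⟩, ?_⟩
      · exact fun h => hne (hinj h)
      · change x - m + (y - m) = x + y - 2 * m
        ring
    have hdiff : B - B ⊆ A - A := by
      intro z hz
      obtain ⟨x, hx, y, hy, rfl⟩ := Finset.mem_sub.1 hz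
      obtain ⟨u, hu, rfl⟩ := Finset.mem_image.1 hx
      obtain ⟨v, hv, rfl⟩ := Finset.mem_image.1 hy
      exact Finset.mem_sub.2 ⟨u, hu, v, hv, by ring⟩
    exact hsum.trans (key.trans (Finset.card_le_card hdiff))
end

section
/- A subset A of {0,1,…,30} is RSD if and only if A is one of the six sets C₁ = {0,1,2,3,6,8,13,16,18,23,24,26,28,29,30}, C₂ = {0,1,2,3,6,9,14,15,17,22,23,26,28,29,30}, C₃ = {0,1,2,4,5,8,9,14,18,21,22,26,27,28,30}, C₄ = {0,1,2,4,6,7,12,14,17,22,24,27,28,29,30}, C₅ = {0,1,2,4,7,8,13,15,16,21,24,27,28,29,30}, C₆ = {0,2,3,4,8,9,12,16,21,22,25,26,28,29,30}. -/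
open Pointwise

/-! ## A bit-sliced exhaustive search

A natural number `t < 2 ^ (2 ^ k)` is the truth table of a Boolean function of the `k` "free"
elements `6, …, 23` (`k = 18`); the other elements are decided by branching.  A state consists of
the lists `V` (membership of `0..30`), `S` (membership of `0..60` in the restricted sumset) and `D`
(membership of `1..30` in the difference set). All functions below are written with explicit
recursors so that the kernel evaluates them quickly. -/

namespace RSD

noncomputable section

def bcond {α : Type} (b : Bool) (x y : α) : α := Bool.rec (motive := fun _ => α) y x b

def orM (M e u : Nat) : Nat :=
  bcond (Nat.beq u 0) e (bcond (Nat.beq e M) e (Nat.lor e u))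

def zipOp (op : Nat → Nat → Nat) (es : List Nat) : List Nat → List Nat :=
  List.rec (motive := fun _ => List Nat → List Nat) (fun _ => [])
    (fun e es ih us =>
      List.rec (motive := fun _ => List Nat) (e :: es) (fun u us _ => op e u :: ih us) us) es

def addAt (op : Nat → Nat → Nat) (a : Nat) (V : List Nat) : List Nat → List Nat :=
  Nat.rec (motive := fun _ => List Nat → List Nat) (fun S => zipOp op S V)
    (fun _ ih S => List.rec (motive := fun _ => List Nat) [] (fun e S _ => e :: ih S) S) a

def dropL (a : Nat) : List Nat → List Nat :=
  Nat.rec (motive := fun _ => List Nat → List Nat) (fun V => V)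
    (fun _ ih V => List.rec (motive := fun _ => List Nat) [] (fun _ V _ => ih V) V) a

def revTake (a : Nat) : List Nat → List Nat → List Nat :=
  Nat.rec (motive := fun _ => List Nat → List Nat → List Nat) (fun _ acc => acc)
    (fun _ ih V acc =>
      List.rec (motive := fun _ => List Nat) acc (fun v V _ => ih V (v :: acc)) V) a

def setL (a : Nat) (t : Nat) : List Nat → List Nat :=
  Nat.rec (motive := fun _ => List Nat → List Nat)
    (fun V => List.rec (motive := fun _ => List Nat) [] (fun _ V _ => t :: V) V)
    (fun _ ih V => List.rec (motive := fun _ => List Nat) [] (fun v V _ => v :: ih V) V) a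

def addD (op : Nat → Nat → Nat) (a : Nat) (V D : List Nat) : List Nat :=
  zipOp op (zipOp op D (dropL (Nat.succ a) V)) (revTake a V [])

/-- Add up the slices of `l` (with pending slice `b` if `p`) and `s`, by full adders: the
continuation gets the resulting bit slice and the list of carries. -/
def colAux (K : Nat → List Nat → Nat) (l : List Nat) : Bool → Nat → Nat → List Nat → Nat :=
  List.rec (motive := fun _ => Bool → Nat → Nat → List Nat → Nat)
    (fun p b s acc => bcond p (K (Nat.xor s b) (Nat.land s b :: acc)) (K s acc))
    (fun c _ ih p b s acc => bcond p
      (ih false 0 (Nat.xor (Nat.xor s b) c)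
        (Nat.lor (Nat.land s b) (Nat.land (Nat.xor s b) c) :: acc))
      (ih true c s acc)) l

def col0 (K : Nat → List Nat → Nat) (l : List Nat) : Nat :=
  List.rec (motive := fun _ => Nat) (K 0 []) (fun b r _ => colAux K r false 0 b []) l

def app (l m : List Nat) : List Nat :=
  List.rec (motive := fun _ => List Nat) m (fun x _ ih => x :: ih) l

/-- The truth table of `T < v ∨ (T = v ∧ g)`, `v` the number of slices in `bits` plus twice the
number of slices in `inj`. -/
def sumGe (n : Nat) : List Nat → List Nat → Nat → Nat → Nat :=
  Nat.rec (motive := fun _ => List Nat → List Nat → Nat → Nat → Nat)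
    (fun _ _ T g => bcond (Nat.beq T 0) g 0)
    (fun _ ih bits inj T g => col0 (fun s c => ih (app c inj) [] (Nat.div T 2)
        (bcond (Nat.beq (Nat.mod T 2) 1) (Nat.land s g) (Nat.lor s g))) bits) n

def cnt (M : Nat) (l : List Nat) : Nat :=
  List.rec (motive := fun _ => Nat) 0 (fun e _ ih => bcond (Nat.beq e M) (Nat.succ ih) ih) l

def filtS (M : Nat) (l : List Nat) : List Nat :=
  List.rec (motive := fun _ => List Nat) []
    (fun e _ ih => bcond (Nat.beq e M) ih (bcond (Nat.beq e 0) ih (e :: ih))) l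

def filtD (M : Nat) (l : List Nat) : List Nat :=
  List.rec (motive := fun _ => List Nat) []
    (fun e _ ih => bcond (Nat.beq e M) ih (bcond (Nat.beq e 0) ih (Nat.xor e M :: ih))) l

/-- The truth table of `2 + 2 * 30 ≤ (size of S) + 2 * (30 - size of D)`. -/
def leafVal (M : Nat) (S D : List Nat) : Nat :=
  sumGe 7 (filtS M S) (filtD M D) (Nat.sub (Nat.sub 62 (cnt M S)) (Nat.mul 2 (cnt 0 D))) M

/-- The six exceptional sets: decided elements, and the free part as a bit mask. -/
def exc : List (List Nat × Nat) :=
  [([24, 26, 28, 29, 30, 3, 2, 1, 0], 136325), ([26, 28, 29, 30, 3, 2, 1, 0], 199433),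
   ([26, 27, 28, 30, 5, 4, 2, 1, 0], 102668), ([24, 27, 28, 29, 30, 4, 2, 1, 0], 67907),
   ([24, 27, 28, 29, 30, 4, 2, 1, 0], 34438), ([25, 26, 28, 29, 30, 4, 3, 2, 0], 99404)]

def excTab (f : List Nat) : List (List Nat × Nat) → Nat
  | [] => 0
  | p :: l => bcond (decide (f = p.1)) (Nat.lor (Nat.pow 2 p.2) (excTab f l)) (excTab f l)

def leafOk (R : Nat) (f : List Nat) : Bool :=
  bcond (Nat.beq R 0) true (Nat.beq R (excTab f exc))

/-- Branch over the elements of `F`. -/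
def run (M : Nat) (F : List Nat) : List Nat → List Nat → List Nat → List Nat → Bool :=
  List.rec (motive := fun _ => List Nat → List Nat → List Nat → List Nat → Bool)
    (fun _ S D f => leafOk (leafVal M S D) f)
    (fun a _ ih V S D f =>
      bcond (ih (setL a M V) (addAt (orM M) a V S) (addD (orM M) a V D) (a :: f))
        (ih V S D f) false) F

def opT (t e u : Nat) : Nat := bcond (Nat.beq u 0) e (Nat.lor e (Nat.land u t))

/-- Add the free elements `a, a + 1, …` with truth tables `ts`. -/
def free (K : List Nat → List Nat → List Nat → Bool) (ts : List Nat) :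
    Nat → List Nat → List Nat → List Nat → Bool :=
  List.rec (motive := fun _ => Nat → List Nat → List Nat → List Nat → Bool)
    (fun _ V S D => K V S D)
    (fun t _ ih a V S D =>
      ih (Nat.succ a) (setL a t V) (addAt (opT t) a V S) (addD (opT t) a V D)) ts

def full (k : Nat) : Nat := Nat.sub (Nat.pow 2 (Nat.pow 2 k)) 1

def tabs : Nat → List Nat
  | 0 => []
  | k + 1 => (tabs k).map (fun x => Nat.lor x (Nat.shiftLeft x (Nat.pow 2 k))) ++
      [Nat.shiftLeft (full k) (Nat.pow 2 k)]

/-- Decide the elements of `F` according to the binary digits of `i`. -/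
def pre (M : Nat) (K : List Nat → List Nat → List Nat → List Nat → Bool) (F : List Nat) :
    Nat → List Nat → List Nat → List Nat → List Nat → Bool :=
  List.rec (motive := fun _ => Nat → List Nat → List Nat → List Nat → List Nat → Bool)
    (fun _ V S D f => K V S D f)
    (fun a _ ih i V S D f =>
      bcond (Nat.beq (Nat.mod i 2) 1)
        (ih (Nat.div i 2) (setL a M V) (addAt (orM M) a V S) (addD (orM M) a V D) (a :: f))
        (ih (Nat.div i 2) V S D f)) F

def F1 : List Nat := [1, 2, 3, 4, 5, 30, 29]
def F2 : List Nat := [28, 27, 26, 25, 24]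

def check (i : Nat) : Bool :=
  free (fun V S D => pre (full 18) (run (full 18) F2) F1 i
      (setL 0 (full 18) V) (addAt (orM (full 18)) 0 V S) (addD (orM (full 18)) 0 V D) [0])
    (tabs 18) 6 (List.replicate 31 0) (List.replicate 61 0) (List.replicate 30 0)

end


set_option maxHeartbeats 0 in
set_option maxRecDepth 100000 in
theorem check_all (i : Nat) (hi : i < 128) : check i = true := by
  interval_cases i <;> decide +kernel


/-! ## Correctness of the search -/

@[simp] theorem bcond_true {α : Type} (x y : α) : bcond true x y = x := rfl
@[simp] theorem bcond_false {α : Type} (x y : α) : bcond false x y = y := rfl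

theorem beq_of {a b : Nat} (h : Nat.beq a b = true) : a = b := Nat.eq_of_beq_eq_true h

/-- Bit `j` of the `i`-th entry. -/
def bt (j : Nat) (l : List Nat) (i : Nat) : Bool := (l.getD i 0).testBit j

@[simp] theorem bt_nil (j i : Nat) : bt j [] i = false := by simp [bt]
@[simp] theorem bt_zero (j x : Nat) (l : List Nat) : bt j (x :: l) 0 = x.testBit j := by simp [bt]
@[simp] theorem bt_succ (j x : Nat) (l : List Nat) (i : Nat) :
    bt j (x :: l) (i + 1) = bt j l i := by simp [bt]

/-- `op` is "or" (guarded by `b`) at position `j`. -/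
def IsOp (j : Nat) (b : Bool) (op : Nat → Nat → Nat) : Prop :=
  ∀ e u, (op e u).testBit j = (e.testBit j || (u.testBit j && b))

theorem isOp_orM {j M : Nat} (hM : M.testBit j = true) : IsOp j true (orM M) := by
  intro e u
  unfold orM
  cases h : Nat.beq u 0
  · cases h' : Nat.beq e M
    · exact (Nat.testBit_or e u j).trans (by simp)
    · have := beq_of h'
      subst this
      simp [hM]
  · have := beq_of h
    subst this
    simp

theorem isOp_opT (j t : Nat) : IsOp j (t.testBit j) (opT t) := by
  intro e u
  unfold opT
  cases h : Nat.beq u 0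
  · exact (Nat.testBit_or e _ j).trans (congrArg _ (Nat.testBit_and u t j))
  · have := beq_of h
    subst this
    simp

theorem zipOp_length (op : Nat → Nat → Nat) (es us : List Nat) :
    (zipOp op es us).length = es.length := by
  induction es generalizing us with
  | nil => rfl
  | cons e es ih =>
    cases us with
    | nil => rfl
    | cons u us => exact congrArg Nat.succ (ih us)

theorem bt_zipOp {j : Nat} {b : Bool} {op : Nat → Nat → Nat} (h : IsOp j b op) (es us : List Nat)
    (i : Nat) (hi : i < es.length) :
    bt j (zipOp op es us) i = (bt j es i || (bt j us i && b)) := by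
  induction es generalizing us i with
  | nil => simp at hi
  | cons e es ih =>
    cases us with
    | nil => show bt j (e :: es) i = _; simp
    | cons u us =>
      show bt j (op e u :: zipOp op es us) i = _
      cases i with
      | zero => simpa using h e u
      | succ i => simpa using ih us i (by simpa using hi)

theorem addAt_length (op : Nat → Nat → Nat) (a : Nat) (V S : List Nat) :
    (addAt op a V S).length = S.length := by
  induction a generalizing S with
  | zero => exact zipOp_length op S V
  | succ a ih =>
    cases S with
    | nil => rfl
    | cons e S => exact congrArg Nat.succ (ih S)

theorem bt_addAt {j : Nat} {b : Bool} {op : Nat → Nat → Nat} (h : IsOp j b op) (a : Nat)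
    (V S : List Nat) (i : Nat) (hi : i < S.length) :
    bt j (addAt op a V S) i = (bt j S i || (decide (a ≤ i) && bt j V (i - a) && b)) := by
  induction a generalizing S i with
  | zero =>
    show bt j (zipOp op S V) i = _
    rw [bt_zipOp h _ _ _ hi]; simp
  | succ a ih =>
    cases S with
    | nil => simp at hi
    | cons e S =>
      show bt j (e :: addAt op a V S) i = _
      cases i with
      | zero => simp
      | succ i =>
        rw [bt_succ, ih S i (by simpa using hi)]
        simp

theorem bt_dropL (j a : Nat) (V : List Nat) (i : Nat) : bt j (dropL a V) i = bt j V (a + i) := by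
  induction a generalizing V with
  | zero => simp [dropL]
  | succ a ih =>
    cases V with
    | nil => show bt j [] i = _; simp
    | cons v V =>
      show bt j (dropL a V) i = _
      rw [ih, Nat.add_right_comm, bt_succ]

theorem revTake_eq (a : Nat) (V acc : List Nat) : revTake a V acc = (V.take a).reverse ++ acc := by
  induction a generalizing V acc with
  | zero => simp [revTake]
  | succ a ih =>
    cases V with
    | nil => show acc = _; simp
    | cons v V =>
      show revTake a V (v :: acc) = _
      rw [ih]; simp

theorem bt_revTake (j a : Nat) (V : List Nat) (ha : a ≤ V.length) (i : Nat) :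
    bt j (revTake a V []) i = (decide (i < a) && bt j V (a - 1 - i)) := by
  rw [revTake_eq, List.append_nil]
  unfold bt
  by_cases hi : i < a
  · have h1 : i < (V.take a).reverse.length := by simp; omega
    have h2 : a - 1 - i < V.length := by omega
    simp only [List.getD_eq_getElem _ _ h1, List.getD_eq_getElem _ _ h2, hi, decide_true,
      Bool.true_and, List.getElem_reverse, List.getElem_take, List.length_take]
    congr 2
    omega
  · rw [List.getD_eq_default]
    · simp [hi]
    · simp; omega

theorem setL_eq (a t : Nat) (V : List Nat) : setL a t V = V.set a t := by
  induction a generalizing V with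
  | zero => cases V <;> rfl
  | succ a ih =>
    cases V with
    | nil => rfl
    | cons v V => exact congrArg (List.cons v) (ih V)

theorem bt_setL (j a t : Nat) (V : List Nat) (ha : a < V.length) (i : Nat) :
    bt j (setL a t V) i = if i = a then t.testBit j else bt j V i := by
  rw [setL_eq]
  unfold bt
  simp only [List.getD_eq_getElem?_getD, List.getElem?_set]
  by_cases h : i = a
  · subst h; simp [ha]
  · simp [h, Ne.symm h]

theorem bt_addD {j : Nat} {b : Bool} {op : Nat → Nat → Nat} (h : IsOp j b op) (a : Nat)
    (V D : List Nat) (ha : a ≤ V.length) (i : Nat) (hi : i < D.length) :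
    bt j (addD op a V D) i = (bt j D i || (bt j V (a + 1 + i) && b) ||
      (decide (i < a) && bt j V (a - 1 - i) && b)) := by
  unfold addD
  rw [bt_zipOp h _ _ _ (by rwa [zipOp_length]), bt_zipOp h _ _ _ hi, bt_dropL, bt_revTake _ _ _ ha]

/-- At position `j` the state describes the set `B`. -/
structure Rep (j : Nat) (V S D : List Nat) (B : Finset ℕ) : Prop where
  lV : V.length = 31
  lS : S.length = 61
  lD : D.length = 30
  hV : ∀ i, i < 31 → (bt j V i = true ↔ i ∈ B)
  hS : ∀ s, s < 61 → (bt j S s = true ↔ ∃ a ∈ B, ∃ b ∈ B, a ≠ b ∧ a + b = s)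
  hD : ∀ i, i < 30 → (bt j D i = true ↔ ∃ a ∈ B, a + (i + 1) ∈ B)
  hB : ∀ i ∈ B, i < 31

theorem bt_ge (j : Nat) (V : List Nat) (i : Nat) (h : V.length ≤ i) : bt j V i = false := by
  unfold bt; rw [List.getD_eq_default _ _ h]; simp

theorem Rep.hV' {j : Nat} {V S D : List Nat} {B : Finset ℕ} (h : Rep j V S D B) (i : Nat) :
    bt j V i = true ↔ i ∈ B := by
  by_cases hi : i < 31
  · exact h.hV i hi
  · rw [bt_ge _ _ _ (by rw [h.lV]; omega)]
    simp only [Bool.false_eq_true, false_iff]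
    exact fun hh => hi (h.hB i hh)

theorem Rep.step {j : Nat} {V S D : List Nat} {B : Finset ℕ} (h : Rep j V S D B) {a t : Nat}
    {b : Bool} {op : Nat → Nat → Nat} (hop : IsOp j b op) (ht : t.testBit j = b) (ha : a < 31)
    (haB : a ∉ B) :
    Rep j (setL a t V) (addAt op a V S) (addD op a V D) (if b = true then insert a B else B) where
  lV := by rw [setL_eq, List.length_set, h.lV]
  lS := by rw [addAt_length, h.lS]
  lD := by unfold addD; rw [zipOp_length, zipOp_length, h.lD]
  hV := by
    intro i _
    rw [bt_setL _ _ _ _ (by rw [h.lV]; exact ha), ht]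
    by_cases hia : i = a
    · subst hia
      cases b <;> simp [haB]
    · rw [if_neg hia, h.hV' i]
      cases b <;> simp [hia]
  hS := by
    intro s hs
    rw [bt_addAt hop _ _ _ _ (by rw [h.lS]; exact hs)]
    have h1 := h.hS s hs
    have h2 := h.hV' (s - a)
    cases b
    · simpa using h1
    · simp only [Bool.and_true, Bool.or_eq_true, Bool.and_eq_true, decide_eq_true_eq, h1, h2,
        if_true]
      constructor
      · rintro (⟨x, hx, y, hy, hxy, rfl⟩ | ⟨h3, h4⟩)
        · exact ⟨x, by simp [hx], y, by simp [hy], hxy, rfl⟩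
        · refine ⟨a, by simp, s - a, by simp [h4], ?_, by omega⟩
          intro hh
          rw [← hh] at h4
          exact haB h4
      · rintro ⟨x, hx, y, hy, hxy, rfl⟩
        rw [Finset.mem_insert] at hx hy
        rcases hx with rfl | hx
        · rcases hy with rfl | hy
          · exact absurd rfl hxy
          · right; exact ⟨by omega, by simpa using hy⟩
        · rcases hy with rfl | hy
          · right; exact ⟨by omega, by simpa using hx⟩
          · left; exact ⟨x, hx, y, hy, hxy, rfl⟩
  hD := by
    intro i hi
    rw [bt_addD hop _ _ _ (by rw [h.lV]; omega) _ (by rw [h.lD]; exact hi)]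
    have h1 := h.hD i hi
    have h2 := h.hV' (a + 1 + i)
    have h3 := h.hV' (a - 1 - i)
    cases b
    · simpa using h1
    · simp only [Bool.and_true, Bool.or_eq_true, Bool.and_eq_true, decide_eq_true_eq, h1, h2, h3,
        if_true]
      constructor
      · rintro ((⟨x, hx, hy⟩ | h4) | ⟨h4, h5⟩)
        · exact ⟨x, by simp [hx], by simp [hy]⟩
        · refine ⟨a, by simp, ?_⟩
          rw [show a + (i + 1) = a + 1 + i by omega]
          simp [h4]
        · refine ⟨a - 1 - i, by simp [h5], ?_⟩
          rw [show a - 1 - i + (i + 1) = a by omega]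
          simp
      · rintro ⟨x, hx, hy⟩
        rw [Finset.mem_insert] at hx hy
        rcases hx with rfl | hx
        · rcases hy with hy | hy
          · omega
          · left; right
            rwa [show x + 1 + i = x + (i + 1) by omega]
        · rcases hy with hy | hy
          · right
            refine ⟨by omega, ?_⟩
            rwa [show a - 1 - i = x by omega]
          · left; left; exact ⟨x, hx, hy⟩
  hB := by
    intro i hi
    cases b
    · exact h.hB i (by simpa using hi)
    · simp only [if_true, Finset.mem_insert] at hi
      rcases hi with rfl | hi
      · exact ha
      · exact h.hB i hi

/-! ### Counting -/

/-- Number of entries with bit `j` set. -/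
def ct (j : Nat) (l : List Nat) : Nat := l.countP (fun e => e.testBit j)

theorem ct_cons (j e : Nat) (l : List Nat) :
    ct j (e :: l) = ct j l + (e.testBit j).toNat := by
  unfold ct
  rw [List.countP_cons]
  cases e.testBit j <;> simp

theorem colAux_spec (j : Nat) (K : Nat → List Nat → Nat) (l : List Nat) (p : Bool) (b s : Nat)
    (acc : List Nat) : ∃ s' c, colAux K l p b s acc = K s' c ∧
      (s'.testBit j).toNat + 2 * ct j c =
        (s.testBit j).toNat + 2 * ct j acc + ct j l + (p && b.testBit j).toNat := by
  induction l generalizing p b s acc with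
  | nil =>
    cases p
    · exact ⟨s, acc, rfl, by simp [ct]⟩
    · refine ⟨Nat.xor s b, Nat.land s b :: acc, rfl, ?_⟩
      rw [ct_cons]
      have e1 : (Nat.xor s b).testBit j = _ := Nat.testBit_xor s b j
      have e2 : (Nat.land s b).testBit j = _ := Nat.testBit_and s b j
      rw [e1, e2]
      have : ct j [] = 0 := rfl
      rw [this]
      cases s.testBit j <;> cases b.testBit j <;> simp <;> omega
  | cons c l ih =>
    cases p
    · obtain ⟨s', c', h1, h2⟩ := ih true c s acc
      refine ⟨s', c', h1, ?_⟩
      rw [h2, ct_cons]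
      simp
      omega
    · obtain ⟨s', c', h1, h2⟩ := ih false 0 (Nat.xor (Nat.xor s b) c)
        (Nat.lor (Nat.land s b) (Nat.land (Nat.xor s b) c) :: acc)
      refine ⟨s', c', h1, ?_⟩
      rw [h2, ct_cons, ct_cons]
      have e1 : (Nat.xor s b).testBit j = _ := Nat.testBit_xor s b j
      have e2 : (Nat.land s b).testBit j = _ := Nat.testBit_and s b j
      have e3 : (Nat.xor (Nat.xor s b) c).testBit j = _ := Nat.testBit_xor (Nat.xor s b) c j
      have e4 : (Nat.land (Nat.xor s b) c).testBit j = _ := Nat.testBit_and (Nat.xor s b) c j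
      have e5 : (Nat.lor (Nat.land s b) (Nat.land (Nat.xor s b) c)).testBit j = _ :=
        Nat.testBit_or (Nat.land s b) (Nat.land (Nat.xor s b) c) j
      rw [e5, e4, e3, e2, e1]
      cases s.testBit j <;> cases b.testBit j <;> cases c.testBit j <;> simp <;> omega

theorem col0_spec (j : Nat) (K : Nat → List Nat → Nat) (l : List Nat) :
    ∃ s' c, col0 K l = K s' c ∧ (s'.testBit j).toNat + 2 * ct j c = ct j l := by
  cases l with
  | nil => exact ⟨0, [], rfl, by simp [ct]⟩
  | cons b r =>
    obtain ⟨s', c, h1, h2⟩ := colAux_spec j K r false 0 b []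
    refine ⟨s', c, h1, ?_⟩
    rw [h2, ct_cons]
    simp [ct]
    omega

theorem app_eq (l m : List Nat) : app l m = l ++ m := by
  induction l with
  | nil => rfl
  | cons x l ih => exact congrArg (List.cons x) ih

theorem sumGe_spec (j n : Nat) (bits inj : List Nat) (T g : Nat)
    (h : ct j bits + 2 * ct j inj < 2 ^ n) :
    (sumGe n bits inj T g).testBit j = true ↔
      T < ct j bits + 2 * ct j inj ∨ (T = ct j bits + 2 * ct j inj ∧ g.testBit j = true) := by
  induction n generalizing bits inj T g with
  | zero =>
    have h0 : ct j bits + 2 * ct j inj = 0 := by simpa using h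
    rw [h0]
    show (bcond (Nat.beq T 0) g 0).testBit j = true ↔ _
    cases hT : Nat.beq T 0
    · have := Nat.ne_of_beq_eq_false hT
      simp [this]
    · have := beq_of hT
      simp [this]
  | succ n ih =>
    obtain ⟨s, c, h1, h2⟩ := col0_spec j (fun s c => sumGe n (app c inj) [] (Nat.div T 2)
        (bcond (Nat.beq (Nat.mod T 2) 1) (Nat.land s g) (Nat.lor s g))) bits
    have e : sumGe (n + 1) bits inj T g = sumGe n (app c inj) [] (Nat.div T 2)
        (bcond (Nat.beq (Nat.mod T 2) 1) (Nat.land s g) (Nat.lor s g)) := h1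
    have hc : ct j (app c inj) = ct j c + ct j inj := by
      rw [app_eq]; simp [ct]
    have h0 : ct j [] = 0 := rfl
    rw [e, ih _ _ _ _ (by rw [hc, h0]; rw [pow_succ] at h; omega), hc, h0]
    have e1 : (Nat.land s g).testBit j = _ := Nat.testBit_and s g j
    have e2 : (Nat.lor s g).testBit j = _ := Nat.testBit_or s g j
    have e3 : Nat.div T 2 = T / 2 := rfl
    have e4 : Nat.mod T 2 = T % 2 := rfl
    rw [e3, e4, ← h2]
    cases hT : Nat.beq (T % 2) 1
    · have hT' := Nat.ne_of_beq_eq_false hT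
      rw [bcond_false, e2]
      cases s.testBit j <;> cases g.testBit j <;> simp <;> omega
    · have hT' := beq_of hT
      rw [bcond_true, e1]
      cases s.testBit j <;> cases g.testBit j <;> simp <;> omega

theorem cnt_filtS {j M : Nat} (hM : M.testBit j = true) (l : List Nat) :
    cnt M l + ct j (filtS M l) = ct j l := by
  induction l with
  | nil => rfl
  | cons e l ih =>
    rw [ct_cons, ← ih]
    show bcond (Nat.beq e M) (Nat.succ (cnt M l)) (cnt M l) + ct j (bcond (Nat.beq e M) (filtS M l)
      (bcond (Nat.beq e 0) (filtS M l) (e :: filtS M l))) = _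
    cases h : Nat.beq e M
    · cases h' : Nat.beq e 0
      · simp only [bcond_false, ct_cons]; omega
      · have := beq_of h'
        subst this
        simp
    · have := beq_of h
      subst this
      simp [hM]; omega

theorem cnt_filtD {j M : Nat} (hM : M.testBit j = true) (l : List Nat) :
    cnt 0 l + ct j (filtD M l) + ct j l = l.length := by
  induction l with
  | nil => rfl
  | cons e l ih =>
    rw [ct_cons, List.length_cons, ← ih]
    show bcond (Nat.beq e 0) (Nat.succ (cnt 0 l)) (cnt 0 l) + ct j (bcond (Nat.beq e M) (filtD M l)
      (bcond (Nat.beq e 0) (filtD M l) (Nat.xor e M :: filtD M l))) + _ = _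
    cases h : Nat.beq e M
    · cases h' : Nat.beq e 0
      · have e1 : (Nat.xor e M).testBit j = _ := Nat.testBit_xor e M j
        simp only [bcond_false, ct_cons, e1, hM]
        cases e.testBit j <;> simp <;> omega
      · have := beq_of h'
        subst this
        simp; omega
    · have := beq_of h
      subst this
      have h0 : Nat.beq e 0 = false := by
        cases h0 : Nat.beq e 0
        · rfl
        · have := beq_of h0
          subst this
          simp at hM
      simp [hM, h0]; omega

theorem leafVal_spec {j M : Nat} (hM : M.testBit j = true) (S D : List Nat) (hS : S.length = 61)
    (hD : D.length = 30) (h : 62 ≤ ct j S + 2 * (30 - ct j D)) :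
    (leafVal M S D).testBit j = true := by
  have h1 := cnt_filtS hM S
  have h2 := cnt_filtD hM D
  have h3 : ct j S ≤ S.length := List.countP_le_length
  unfold leafVal
  rw [sumGe_spec]
  · have e : Nat.sub (Nat.sub 62 (cnt M S)) (Nat.mul 2 (cnt 0 D)) = 62 - cnt M S - 2 * cnt 0 D :=
      rfl
    rw [e]
    simp only [hM, and_true]
    omega
  · norm_num; omega

theorem ct_eq_card (j : Nat) (l : List Nat) :
    ct j l = ((Finset.range l.length).filter (fun i => bt j l i = true)).card := by
  have h : l = (List.range l.length).map (fun i => l.getD i 0) := by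
    apply List.ext_getElem
    · simp
    · intro i h1 h2
      simp [h1]
  have h2 : ct j l = (List.range l.length).countP (fun i => bt j l i) := by
    conv_lhs => rw [h]
    unfold ct
    rw [List.countP_map]
    rfl
  rw [h2, ← Nat.count_eq_card_filter_range]
  unfold Nat.count
  congr 1
  funext i
  simp

theorem testBit_full {k j : Nat} (h : j < 2 ^ k) : (full k).testBit j = true := by
  have e : full k = 2 ^ (2 ^ k) - 1 := rfl
  rw [e, Nat.testBit_two_pow_sub_one]
  simpa using h

/-! ### The search -/

/-- A leaf of the search for the set `B` has been reached, with decided elements `f`. -/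
def Good (j M : Nat) (B : Finset ℕ) (f : List Nat) : Prop :=
  ∃ V S D, Rep j V S D B ∧ leafOk (leafVal M S D) f = true

/-- The elements of `C` that are no longer to be processed. -/
def rest (C : Finset ℕ) (R : List Nat) : Finset ℕ := C.filter (fun x => x ∉ R)

theorem rest_step (C : Finset ℕ) (a : Nat) (R : List Nat) (hR : a ∉ R) :
    (if decide (a ∈ C) = true then insert a (rest C (a :: R)) else rest C (a :: R)) = rest C R := by
  by_cases h : a ∈ C
  · simp only [h, decide_true, if_true]
    ext x
    simp only [rest, Finset.mem_insert, Finset.mem_filter, List.mem_cons]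
    constructor
    · rintro (rfl | ⟨h1, h2⟩)
      · exact ⟨h, hR⟩
      · exact ⟨h1, fun h3 => h2 (Or.inr h3)⟩
    · rintro ⟨h1, h2⟩
      by_cases hx : x = a
      · exact Or.inl hx
      · exact Or.inr ⟨h1, by rintro (h3 | h3); exacts [hx h3, h2 h3]⟩
  · simp only [h, decide_false, Bool.false_eq_true, if_false]
    ext x
    simp only [rest, Finset.mem_filter, List.mem_cons]
    constructor
    · rintro ⟨h1, h2⟩
      exact ⟨h1, fun h3 => h2 (Or.inr h3)⟩
    · rintro ⟨h1, h2⟩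
      refine ⟨h1, ?_⟩
      rintro (rfl | h3)
      · exact h h1
      · exact h2 h3

theorem not_mem_rest (C : Finset ℕ) (a : Nat) (R : List Nat) : a ∉ rest C (a :: R) := by
  simp [rest]

theorem fix_step {j M : Nat} (hM : M.testBit j = true) {C : Finset ℕ} {a : Nat} {R : List Nat}
    {V S D : List Nat} (h : Rep j V S D (rest C (a :: R))) (haC : a ∈ C) (hR : a ∉ R)
    (ha : a < 31) :
    Rep j (setL a M V) (addAt (orM M) a V S) (addD (orM M) a V D) (rest C R) := by
  have h1 := h.step (isOp_orM hM) hM ha (not_mem_rest C a R)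
  have h2 := rest_step C a R hR
  simp only [haC, decide_true, if_true] at h1 h2
  rwa [h2] at h1

theorem skip_step {j : Nat} {C : Finset ℕ} {a : Nat} {R : List Nat}
    {V S D : List Nat} (h : Rep j V S D (rest C (a :: R))) (haC : a ∉ C) (hR : a ∉ R) :
    Rep j V S D (rest C R) := by
  have h2 := rest_step C a R hR
  simp only [haC, decide_false, Bool.false_eq_true, if_false] at h2
  rwa [h2] at h

theorem run_spec {j M : Nat} (hM : M.testBit j = true) (C : Finset ℕ) (F : List Nat)
    (V S D f : List Nat) (hF : F.Nodup) (hF' : ∀ a ∈ F, a < 31) (h : Rep j V S D (rest C F))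
    (hr : run M F V S D f = true) :
    Good j M (rest C []) ((F.filter (fun x => decide (x ∈ C))).reverse ++ f) := by
  induction F generalizing V S D f with
  | nil => exact ⟨V, S, D, h, hr⟩
  | cons a F ih =>
    have e : run M (a :: F) V S D f = bcond (run M F (setL a M V) (addAt (orM M) a V S)
      (addD (orM M) a V D) (a :: f)) (run M F V S D f) false := rfl
    rw [e] at hr
    rw [List.nodup_cons] at hF
    cases h1 : run M F (setL a M V) (addAt (orM M) a V S) (addD (orM M) a V D) (a :: f)
    · rw [h1] at hr; simp at hr
    · rw [h1, bcond_true] at hr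
      by_cases haC : a ∈ C
      · have := ih _ _ _ _ hF.2 (fun x hx => hF' x (by simp [hx]))
          (fix_step hM h haC hF.1 (hF' a (by simp))) h1
        simpa [haC] using this
      · have := ih _ _ _ _ hF.2 (fun x hx => hF' x (by simp [hx])) (skip_step h haC hF.1) hr
        simpa [haC] using this

theorem pre_spec {j M : Nat} (hM : M.testBit j = true) (C : Finset ℕ) (F G : List Nat)
    (V S D f : List Nat) (hF : (F ++ G).Nodup) (hF' : ∀ a ∈ F ++ G, a < 31)
    (h : Rep j V S D (rest C (F ++ G))) :
    ∃ i, i < 2 ^ F.length ∧ (pre M (run M G) F i V S D f = true →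
      Good j M (rest C []) (((F ++ G).filter (fun x => decide (x ∈ C))).reverse ++ f)) := by
  induction F generalizing V S D f with
  | nil => exact ⟨0, by simp, fun hh => run_spec hM C G V S D f hF hF' h hh⟩
  | cons a F ih =>
    have e : ∀ i, pre M (run M G) (a :: F) i V S D f = bcond (Nat.beq (i % 2) 1)
        (pre M (run M G) F (i / 2) (setL a M V) (addAt (orM M) a V S) (addD (orM M) a V D) (a :: f))
        (pre M (run M G) F (i / 2) V S D f) := fun i => rfl
    rw [List.cons_append, List.nodup_cons] at hF
    rw [List.cons_append] at hF' h
    by_cases haC : a ∈ C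
    · obtain ⟨i, h1, h2⟩ := ih (setL a M V) (addAt (orM M) a V S) (addD (orM M) a V D) (a :: f)
        hF.2 (fun x hx => hF' x (List.mem_cons_of_mem _ hx))
        (fix_step hM h haC hF.1 (hF' a (by simp)))
      refine ⟨2 * i + 1, by rw [List.length_cons, pow_succ]; omega, ?_⟩
      rw [e, show (2 * i + 1) % 2 = 1 by omega, show (2 * i + 1) / 2 = i by omega]
      intro h3
      have := h2 h3
      simpa [haC] using this
    · obtain ⟨i, h1, h2⟩ := ih V S D f
        hF.2 (fun x hx => hF' x (List.mem_cons_of_mem _ hx)) (skip_step h haC hF.1)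
      refine ⟨2 * i, by rw [List.length_cons, pow_succ]; omega, ?_⟩
      rw [e, show (2 * i) % 2 = 0 by omega, show (2 * i) / 2 = i by omega]
      intro h3
      have := h2 h3
      simpa [haC] using this

theorem free_spec {j : Nat} (C : Finset ℕ)
    (G : List Nat) (ts : List Nat) (a : Nat) (V S D : List Nat)
    (hG : (List.range' a ts.length ++ G).Nodup) (ha : a + ts.length ≤ 31)
    (ht : ∀ i, i < ts.length → bt j ts i = decide (a + i ∈ C))
    (h : Rep j V S D (rest C (List.range' a ts.length ++ G))) :
    ∃ V' S' D', Rep j V' S' D' (rest C G) ∧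
      ∀ K : List Nat → List Nat → List Nat → Bool, free K ts a V S D = K V' S' D' := by
  induction ts generalizing a V S D with
  | nil => exact ⟨V, S, D, by simpa using h, fun _ => rfl⟩
  | cons t ts ih =>
    rw [List.length_cons, List.range'_succ, List.cons_append] at h hG
    rw [List.nodup_cons] at hG
    rw [List.length_cons] at ha
    have h0 := ht 0 (by simp)
    simp only [bt_zero, Nat.add_zero] at h0
    have h1 := h.step (isOp_opT j t) rfl (by omega) (not_mem_rest C a _)
    rw [h0, rest_step C a _ hG.1] at h1
    refine ih (a + 1) _ _ _ hG.2 (by omega) ?_ h1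
    intro i hi
    have := ht (i + 1) (by simpa using hi)
    rw [bt_succ] at this
    rw [this, show a + (i + 1) = a + 1 + i by omega]

theorem tabs_length (k : Nat) : (tabs k).length = k := by
  induction k with
  | zero => rfl
  | succ k ih => simp [tabs, ih]


theorem bt_tabs (k j t : Nat) (ht : t < k) :
    bt j (tabs k) t = (decide (j < 2 ^ k) && j.testBit t) := by
  induction k generalizing j with
  | zero => omega
  | succ k ih =>
    have hp : 2 ^ (k + 1) = 2 ^ k + 2 ^ k := by rw [pow_succ]; omega
    by_cases htk : t < k
    · have e : bt j (tabs (k + 1)) t = (bt j (tabs k) t ||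
          (decide (2 ^ k ≤ j) && bt (j - 2 ^ k) (tabs k) t)) := by
        have hl : t < (tabs k).length := by rw [tabs_length]; exact htk
        unfold bt
        rw [tabs, List.getD_append _ _ _ _ (by simpa using hl),
          List.getD_eq_getElem _ _ (by simpa using hl), List.getElem_map,
          List.getD_eq_getElem _ _ hl]
        refine (Nat.testBit_or _ _ j).trans (congrArg _ ?_)
        exact Nat.testBit_shiftLeft _
      rw [e, ih _ htk, ih _ htk]
      by_cases h1 : j < 2 ^ k
      · have h2 : ¬ 2 ^ k ≤ j := by omega
        have h3 : j < 2 ^ (k + 1) := by omega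
        simp [h1, h2, h3]
      · obtain ⟨x, rfl⟩ := Nat.exists_eq_add_of_le (Nat.le_of_not_lt h1)
        rw [Nat.testBit_two_pow_add_gt htk, Nat.add_sub_cancel_left]
        simp [hp]
    · have htk' : t = k := by omega
      subst htk'
      have e : bt j (tabs (t + 1)) t = (decide (2 ^ t ≤ j) && (full t).testBit (j - 2 ^ t)) := by
        unfold bt
        rw [tabs, List.getD_append_right _ _ _ _ (by simp [tabs_length])]
        simp only [List.length_map, tabs_length, Nat.sub_self, List.getD_cons_zero]
        exact Nat.testBit_shiftLeft _
      have e2 : full t = 2 ^ (2 ^ t) - 1 := rfl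
      rw [e, e2, Nat.testBit_two_pow_sub_one]
      by_cases h1 : j < 2 ^ t
      · have h2 : ¬ 2 ^ t ≤ j := by omega
        simp [h2, Nat.testBit_lt_two_pow h1]
      · obtain ⟨x, rfl⟩ := Nat.exists_eq_add_of_le (Nat.le_of_not_lt h1)
        rw [Nat.testBit_two_pow_add_eq, Nat.add_sub_cancel_left, hp]
        by_cases h3 : x < 2 ^ t
        · simp [h3, Nat.testBit_lt_two_pow h3]
        · simp [h3]

theorem excTab_spec (f : List Nat) (j : Nat) (l : List (List Nat × Nat))
    (h : (excTab f l).testBit j = true) : (f, j) ∈ l := by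
  induction l with
  | nil => simp [excTab] at h
  | cons p l ih =>
    rw [excTab] at h
    by_cases hf : f = p.1
    · simp only [hf, decide_true, bcond_true] at h
      have e : (Nat.lor (Nat.pow 2 p.2) (excTab p.1 l)).testBit j = _ :=
        Nat.testBit_or (2 ^ p.2) (excTab p.1 l) j
      rw [e, Bool.or_eq_true, Nat.testBit_two_pow] at h
      rcases h with h | h
      · have h' : p.2 = j := by simpa using h
        rw [hf, ← h']
        exact List.mem_cons_self
      · exact List.mem_cons_of_mem _ (ih (by rw [hf]; exact h))
    · simp only [hf, decide_false, bcond_false] at h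
      exact List.mem_cons_of_mem _ (ih h)

/-- Restricted sums and positive differences (shifted by one) of a set of naturals below `31`. -/
def sums (C : Finset ℕ) : Finset ℕ :=
  (Finset.range 61).filter (fun s => ∃ a ∈ C, ∃ b ∈ C, a ≠ b ∧ a + b = s)

def diffs (C : Finset ℕ) : Finset ℕ :=
  (Finset.range 30).filter (fun i => ∃ a ∈ C, a + (i + 1) ∈ C)

theorem good_leaf {j M : Nat} (hM : M.testBit j = true) {C : Finset ℕ} {f : List Nat}
    (h : Good j M C f) (hC : 1 + 2 * (diffs C).card < (sums C).card) : (f, j) ∈ exc := by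
  obtain ⟨V, S, D, hr, hl⟩ := h
  have h1 : ct j S = (sums C).card := by
    rw [ct_eq_card, hr.lS, sums]
    congr 1
    apply Finset.filter_congr
    intro s hs
    exact hr.hS s (Finset.mem_range.1 hs)
  have h2 : ct j D = (diffs C).card := by
    rw [ct_eq_card, hr.lD, diffs]
    congr 1
    apply Finset.filter_congr
    intro s hs
    exact hr.hD s (Finset.mem_range.1 hs)
  have h4 : ct j D ≤ D.length := List.countP_le_length
  have hD := hr.lD
  have h3 := leafVal_spec hM S D hr.lS hr.lD (by omega)
  unfold leafOk at hl
  cases h5 : Nat.beq (leafVal M S D) 0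
  · rw [h5, bcond_false] at hl
    rw [beq_of hl] at h3
    exact excTab_spec f j exc h3
  · rw [beq_of h5] at h3
    simp at h3

theorem search (C : Finset ℕ) (hC : ∀ a ∈ C, a < 31) (h0 : 0 ∈ C)
    (h : 1 + 2 * (diffs C).card < (sums C).card) :
    ∃ p ∈ exc, ∀ x, x < 31 →
      (x ∈ C ↔ if 6 ≤ x ∧ x < 24 then p.2.testBit (x - 6) = true else x ∈ p.1) := by
  let χ : Fin 18 → Bool := fun t => decide (6 + (t : ℕ) ∈ C)
  let j := Nat.ofBits χ
  have hj : j < 2 ^ 18 := Nat.ofBits_lt_two_pow χ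
  have hjt : ∀ t, t < 18 → j.testBit t = decide (6 + t ∈ C) := fun t ht =>
    Nat.testBit_ofBits_lt χ t ht
  have hM : (full 18).testBit j = true := testBit_full hj
  have hlen : (tabs 18).length = 18 := tabs_length 18
  let G : List Nat := 0 :: (F1 ++ F2)
  have hz : ∀ n i, bt j (List.replicate n 0) i = false := by
    intro n i
    unfold bt
    rw [List.getD_eq_getElem?_getD, List.getElem?_replicate]
    split <;> simp
  have hempty : rest C (List.range' 6 18 ++ G) = ∅ := by
    rw [rest, Finset.filter_eq_empty_iff]
    intro x hx
    have := hC x hx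
    have hall : ∀ x, x < 31 → x ∈ List.range' 6 18 ++ G := by decide
    exact not_not.2 (hall x this)
  have hstart : Rep j (List.replicate 31 0) (List.replicate 61 0) (List.replicate 30 0)
      (rest C (List.range' 6 18 ++ G)) := by
    rw [hempty]
    exact ⟨List.length_replicate, List.length_replicate, List.length_replicate,
      fun i _ => by rw [hz]; simp, fun s _ => by rw [hz]; simp, fun i _ => by rw [hz]; simp,
      by simp⟩
  have key : ∃ i, i < 128 ∧ (check i = true → Good j (full 18) (rest C [])
      (((F1 ++ F2).filter (fun x => decide (x ∈ C))).reverse ++ [0])) := by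
    obtain ⟨V, S, D, h1, hK⟩ := free_spec C G (tabs 18) 6 _ _ _
      (by rw [hlen]; decide) (by rw [hlen]; decide)
      (fun i hi => by
        rw [hlen] at hi
        rw [bt_tabs 18 j i hi, hjt i hi, decide_eq_true hj, Bool.true_and]) (by rw [hlen]; exact hstart)
    have h2 := fix_step hM h1 h0 (by decide) (by omega)
    obtain ⟨i, hi, h3⟩ := pre_spec hM C F1 F2 _ _ _ [0] (by decide) (by decide) h2
    refine ⟨i, hi, fun hc => h3 ?_⟩
    unfold check at hc
    rw [hK] at hc
    exact hc
  obtain ⟨i, hi, hg⟩ := key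
  have hgood := hg (check_all i hi)
  have hrest : rest C [] = C := by simp [rest]
  rw [hrest] at hgood
  refine ⟨_, good_leaf hM hgood h, ?_⟩
  intro x hx
  dsimp only
  split
  · rename_i hx6
    rw [hjt (x - 6) (by omega), show 6 + (x - 6) = x by omega]
    simp
  · rename_i hx6
    have hall : ∀ x, x < 31 → ¬ (6 ≤ x ∧ x < 24) → x = 0 ∨ x ∈ F1 ++ F2 := by decide
    have hx' := hall x hx hx6
    rw [List.mem_append, List.mem_reverse, List.mem_filter, List.mem_singleton]
    constructor
    · intro hxC
      rcases hx' with hx' | hx'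
      · exact Or.inr hx'
      · exact Or.inl ⟨hx', by simpa using hxC⟩
    · rintro (⟨-, hxC⟩ | rfl)
      · simpa using hxC
      · exact h0

def six : List (Finset ℕ) :=
  [{0, 1, 2, 3, 6, 8, 13, 16, 18, 23, 24, 26, 28, 29, 30},
   {0, 1, 2, 3, 6, 9, 14, 15, 17, 22, 23, 26, 28, 29, 30},
   {0, 1, 2, 4, 5, 8, 9, 14, 18, 21, 22, 26, 27, 28, 30},
   {0, 1, 2, 4, 6, 7, 12, 14, 17, 22, 24, 27, 28, 29, 30},
   {0, 1, 2, 4, 7, 8, 13, 15, 16, 21, 24, 27, 28, 29, 30},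
   {0, 2, 3, 4, 8, 9, 12, 16, 21, 22, 25, 26, 28, 29, 30}]

theorem exc_six : ∀ p ∈ exc, (Finset.range 31).filter
    (fun x => if 6 ≤ x ∧ x < 24 then p.2.testBit (x - 6) = true else x ∈ p.1) ∈ six := by
  decide +kernel

theorem search' (C : Finset ℕ) (hC : ∀ a ∈ C, a < 31) (h0 : 0 ∈ C)
    (h : 1 + 2 * (diffs C).card < (sums C).card) : C ∈ six := by
  obtain ⟨p, hp, hx⟩ := search C hC h0 h
  have := exc_six p hp
  convert this using 1
  ext x
  rw [Finset.mem_filter, Finset.mem_range]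
  constructor
  · intro h1
    exact ⟨hC x h1, (hx x (hC x h1)).1 h1⟩
  · rintro ⟨h1, h2⟩
    exact (hx x h1).2 h2

theorem main_aux (A : Finset ℤ) (hA : A ⊆ Finset.Icc 0 30)
    (h : (A - A).card < (restSum A).card) : ∃ C ∈ six, A = C.image (fun x : ℕ => (x : ℤ)) := by
  have hne : A.Nonempty := by
    rw [Finset.nonempty_iff_ne_empty]
    rintro rfl
    simp [restSum] at h
  obtain ⟨m, hm⟩ : ∃ m, m = A.min' hne := ⟨_, rfl⟩
  have hmA : m ∈ A := hm ▸ A.min'_mem hne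
  have hmin : ∀ x ∈ A, m ≤ x := fun x hx => hm ▸ A.min'_le x hx
  have hb : ∀ x ∈ A, 0 ≤ x ∧ x ≤ 30 := fun x hx => Finset.mem_Icc.1 (hA hx)
  let C : Finset ℕ := A.image (fun x => (x - m).toNat)
  have hC : ∀ a : ℕ, a ∈ C ↔ (a : ℤ) + m ∈ A := by
    intro a
    simp only [C, Finset.mem_image]
    constructor
    · rintro ⟨x, hx, rfl⟩
      have := hmin x hx
      rwa [Int.toNat_of_nonneg (by omega), sub_add_cancel]
    · intro ha
      exact ⟨_, ha, by simp⟩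
  have hCb : ∀ a ∈ C, a < 31 := by
    intro a ha
    have h1 := hb _ ((hC a).1 ha)
    have h2 := hb _ hmA
    omega
  have hsum : (restSum A).card ≤ (sums C).card := by
    have hsub : restSum A ⊆ (sums C).image (fun s : ℕ => (s : ℤ) + 2 * m) := by
      intro s hs
      simp only [restSum, Finset.mem_image, Finset.mem_filter, Finset.mem_product] at hs
      obtain ⟨⟨x, y⟩, ⟨⟨hx, hy⟩, hxy⟩, rfl⟩ := hs
      dsimp only at hx hy hxy ⊢
      have hx1 := hmin x hx
      have hy1 := hmin y hy
      obtain ⟨a, ha⟩ := Int.eq_ofNat_of_zero_le (sub_nonneg.2 hx1)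
      obtain ⟨b, hb'⟩ := Int.eq_ofNat_of_zero_le (sub_nonneg.2 hy1)
      have haC : a ∈ C := (hC a).2 (by rwa [← ha, sub_add_cancel])
      have hbC : b ∈ C := (hC b).2 (by rwa [← hb', sub_add_cancel])
      have h1 := hCb a haC
      have h2 := hCb b hbC
      refine Finset.mem_image.2 ⟨a + b, ?_, by push_cast; omega⟩
      rw [sums, Finset.mem_filter, Finset.mem_range]
      refine ⟨by omega, a, haC, b, hbC, ?_, rfl⟩
      intro hab
      apply hxy
      omega
    exact (Finset.card_le_card hsub).trans Finset.card_image_le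
  have hdiff : 1 + 2 * (diffs C).card ≤ (A - A).card := by
    have hd : ∀ i ∈ diffs C, ∃ x ∈ A, x + ((i : ℤ) + 1) ∈ A := by
      intro i hi
      obtain ⟨-, a, ha, hai⟩ := Finset.mem_filter.1 hi
      refine ⟨_, (hC a).1 ha, ?_⟩
      have := (hC _).1 hai
      push_cast at this
      rwa [show (a : ℤ) + m + (i + 1) = a + (i + 1) + m by ring]
    let P := (diffs C).image (fun i : ℕ => (i : ℤ) + 1)
    let N := (diffs C).image (fun i : ℕ => -((i : ℤ) + 1))
    have hP : P.card = (diffs C).card :=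
      Finset.card_image_of_injective _ (fun x y hxy => by
        have : (x : ℤ) + 1 = (y : ℤ) + 1 := hxy
        omega)
    have hN : N.card = (diffs C).card :=
      Finset.card_image_of_injective _ (fun x y hxy => by
        have : -((x : ℤ) + 1) = -((y : ℤ) + 1) := hxy
        omega)
    have hPN : Disjoint P N := by
      rw [Finset.disjoint_left]
      intro x hx hy
      obtain ⟨i, -, hi⟩ := Finset.mem_image.1 hx
      obtain ⟨k, -, hk⟩ := Finset.mem_image.1 hy
      omega
    have h0 : (0 : ℤ) ∉ P ∪ N := by
      intro hx
      rcases Finset.mem_union.1 hx with hx | hx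
      · obtain ⟨i, -, hi⟩ := Finset.mem_image.1 hx
        omega
      · obtain ⟨i, -, hi⟩ := Finset.mem_image.1 hx
        omega
    have hsub : insert 0 (P ∪ N) ⊆ A - A := by
      intro x hx
      rw [Finset.mem_sub]
      rcases Finset.mem_insert.1 hx with rfl | hx
      · exact ⟨m, hmA, m, hmA, sub_self m⟩
      · rcases Finset.mem_union.1 hx with hx | hx
        · obtain ⟨i, hi, rfl⟩ := Finset.mem_image.1 hx
          obtain ⟨y, hy, hy'⟩ := hd i hi
          exact ⟨_, hy', y, hy, by ring⟩
        · obtain ⟨i, hi, rfl⟩ := Finset.mem_image.1 hx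
          obtain ⟨y, hy, hy'⟩ := hd i hi
          exact ⟨y, hy, _, hy', by ring⟩
    have := Finset.card_le_card hsub
    rw [Finset.card_insert_of_notMem h0, Finset.card_union_of_disjoint hPN, hP, hN] at this
    omega
  have h0 : 0 ∈ C := (hC 0).2 (by simpa using hmA)
  have hsix := search' C hCb h0 (by omega)
  have h30 : 30 ∈ C := by
    have hall : ∀ c ∈ six, 30 ∈ c := by decide
    exact hall C hsix
  have hm0 : m = 0 := by
    have h1 := hb _ ((hC 30).1 h30)
    have h2 := hb _ hmA
    push_cast at h1
    omega
  refine ⟨C, hsix, ?_⟩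
  ext x
  rw [Finset.mem_image]
  constructor
  · intro hx
    have h1 := hb x hx
    obtain ⟨a, rfl⟩ := Int.eq_ofNat_of_zero_le h1.1
    exact ⟨a, (hC a).2 (by rw [hm0]; simpa using hx), rfl⟩
  · rintro ⟨a, ha, rfl⟩
    have := (hC a).1 ha
    rwa [hm0, add_zero] at this

end RSD


theorem rsd_subsets_of_0_30 :
    ∀ A : Finset ℤ, A ⊆ Finset.Icc 0 30 →
      ((A - A).card < (restSum A).card ↔
        A = ({0, 1, 2, 3, 6, 8, 13, 16, 18, 23, 24, 26, 28, 29, 30} : Finset ℤ) ∨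
        A = ({0, 1, 2, 3, 6, 9, 14, 15, 17, 22, 23, 26, 28, 29, 30} : Finset ℤ) ∨
        A = ({0, 1, 2, 4, 5, 8, 9, 14, 18, 21, 22, 26, 27, 28, 30} : Finset ℤ) ∨
        A = ({0, 1, 2, 4, 6, 7, 12, 14, 17, 22, 24, 27, 28, 29, 30} : Finset ℤ) ∨
        A = ({0, 1, 2, 4, 7, 8, 13, 15, 16, 21, 24, 27, 28, 29, 30} : Finset ℤ) ∨
        A = ({0, 2, 3, 4, 8, 9, 12, 16, 21, 22, 25, 26, 28, 29, 30} : Finset ℤ)) := by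
  intro A hA
  constructor
  · intro h
    obtain ⟨C, hC, rfl⟩ := RSD.main_aux A hA h
    simp only [RSD.six, List.mem_cons, List.not_mem_nil, or_false] at hC
    rcases hC with rfl | rfl | rfl | rfl | rfl | rfl
    · exact Or.inl (by decide)
    · exact Or.inr (Or.inl (by decide))
    · exact Or.inr (Or.inr (Or.inl (by decide)))
    · exact Or.inr (Or.inr (Or.inr (Or.inl (by decide))))
    · exact Or.inr (Or.inr (Or.inr (Or.inr (Or.inl (by decide)))))
    · exact Or.inr (Or.inr (Or.inr (Or.inr (Or.inr (by decide)))))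
  · rintro (rfl | rfl | rfl | rfl | rfl | rfl) <;> decide +kernel
end
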